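/- arXiv:1409.1511 — 4 statements merged into one kernel-verified Lean document; each statement's English description precedes it below -/
import Mathlib

section
/- Let a, b, r, s be positive integers with a² < b, and set q = a/b and t = r/s. Then the Rogers–Ramanujan continued fraction RR(q,t) = K_{n=1}^∞ (q^n t)/1, with partial numerators a_n = q^n t and all partial denominators equal to 1, converges to an irrational number, and μ_I(RR(q,t)) ≤ 2 + (2 log a)/(log b − 2 log a). In particular, when a = 1 one has μ_I(RR(1/b, t)) = 2 for every integer b ≥ 2. -/
open Filter

/-- The asymptotic irrationality exponent: the infimum (in `EReal`, so that the
infimum of the empty set is `∞`) of all real `μ` for which there exist `c > 0`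
and `N₀ > 0` with `|τ - M/N| ≥ c / N ^ μ` for all integers `M, N` with `N ≥ N₀`. -/
noncomputable def muI (τ : ℝ) : EReal :=
  sInf ((fun μ : ℝ => (μ : EReal)) ''
    {μ : ℝ | ∃ c > (0:ℝ), ∃ N₀ > (0:ℝ), ∀ M N : ℤ,
      (N : ℝ) ≥ N₀ → |τ - (M : ℝ) / (N : ℝ)| ≥ c / (N : ℝ) ^ μ})

/-- Numerators of the convergents of the generalized continued fraction
`K_{n=1}^∞ a n / b n` with rational partial coefficients. -/
def cfAQ (a b : ℕ → ℚ) : ℕ → ℚ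
  | 0 => 0
  | 1 => a 1
  | (n + 2) => b (n + 2) * cfAQ a b (n + 1) + a (n + 2) * cfAQ a b n

/-- Denominators of the convergents of the generalized continued fraction
`K_{n=1}^∞ a n / b n` with rational partial coefficients. -/
def cfBQ (a b : ℕ → ℚ) : ℕ → ℚ
  | 0 => 1
  | 1 => b 1
  | (n + 2) => b (n + 2) * cfBQ a b (n + 1) + a (n + 2) * cfBQ a b n

/-- The set of exponents whose infimum defines `muI`. -/
def IsIrrExponent (τ μ : ℝ) : Prop :=
  ∃ c > (0:ℝ), ∃ N₀ > (0:ℝ), ∀ M N : ℤ,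
    (N : ℝ) ≥ N₀ → |τ - (M : ℝ) / (N : ℝ)| ≥ c / (N : ℝ) ^ μ

theorem muI_le_of_forall_gt {τ x : ℝ} (h : ∀ μ : ℝ, x < μ → IsIrrExponent τ μ) :
    muI τ ≤ (x : EReal) := by
  refine le_of_forall_gt_imp_ge_of_dense fun y hy => ?_
  obtain ⟨μ, h1, h2⟩ := EReal.lt_iff_exists_real_btwn.1 hy
  have hle : muI τ ≤ (μ : EReal) := sInf_le ⟨μ, h μ (EReal.coe_lt_coe_iff.1 h1), rfl⟩
  exact hle.trans h2.le

/-- By Dirichlet's approximation theorem every exponent is at least `2`. -/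
theorem IsIrrExponent.two_le {τ μ : ℝ} (h : IsIrrExponent τ μ) : 2 ≤ μ := by
  obtain ⟨c, hc, N₀, hN₀, h⟩ := h
  by_contra! hμ
  have hlim : Tendsto (fun n : ℕ => (n : ℝ) ^ (-(2 - μ))) atTop (nhds 0) :=
    (tendsto_rpow_neg_atTop (by linarith)).comp tendsto_natCast_atTop_atTop
  obtain ⟨N₁, hN₁c, hN₁0, hN₁1⟩ := ((hlim.eventually_lt_const hc).and
    ((tendsto_natCast_atTop_atTop.eventually_ge_atTop N₀).and (eventually_ge_atTop 1))).exists
  have hN₁' : (1 : ℝ) ≤ N₁ := by exact_mod_cast hN₁1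
  obtain ⟨n, hn⟩ := exists_nat_gt ((N₁ : ℝ) ^ 4 / c)
  have hn0 : 0 < n := by
    have : (0 : ℝ) < n := lt_of_le_of_lt (by positivity) hn
    exact_mod_cast this
  obtain ⟨j, k, hk0, hkn, hjk⟩ := Real.exists_int_int_abs_mul_sub_le τ hn0
  have hk : (0 : ℝ) < k := by exact_mod_cast hk0
  have hk1 : (1 : ℝ) ≤ k := by exact_mod_cast hk0
  have hkn' : (k : ℝ) ≤ n := by exact_mod_cast hkn
  have hn' : (0 : ℝ) < n := by exact_mod_cast hn0
  have happ : |τ - j / k| ≤ 1 / (k * (n + 1)) := by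
    have : τ - j / k = (k * τ - j) / k := by field_simp
    rw [this, abs_div, abs_of_pos hk, div_le_iff₀ hk]
    refine hjk.trans (le_of_eq ?_)
    field_simp
  rcases le_total (N₁ : ℝ) k with hcase | hcase
  · have h1 := (h j k (hN₁0.trans hcase)).le.trans happ
    have h2 : 1 / ((k : ℝ) * (n + 1)) ≤ 1 / (k : ℝ) ^ (2 : ℝ) := by
      rw [Real.rpow_two]
      apply one_div_le_one_div_of_le (by positivity)
      nlinarith
    have h3 : c ≤ (k : ℝ) ^ (-(2 - μ)) := by
      have h4 := h1.trans h2
      rw [div_le_iff₀ (by positivity)] at h4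
      rw [neg_sub, Real.rpow_sub hk]
      simpa [div_eq_mul_inv, mul_comm] using h4
    have h5 : (k : ℝ) ^ (-(2 - μ)) ≤ (N₁ : ℝ) ^ (-(2 - μ)) :=
      Real.rpow_le_rpow_of_nonpos (by linarith) hcase (by linarith)
    linarith
  · have hN : ((N₁ * k : ℤ) : ℝ) ≥ N₀ := by
      push_cast
      nlinarith
    have h1 := h (N₁ * j) (N₁ * k) hN
    push_cast at h1
    rw [mul_div_mul_left _ _ (by positivity)] at h1
    have h2 : ((N₁ : ℝ) * k) ^ μ ≤ (N₁ : ℝ) ^ 4 := by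
      calc ((N₁ : ℝ) * k) ^ μ ≤ ((N₁ : ℝ) * k) ^ (2 : ℝ) :=
            Real.rpow_le_rpow_of_exponent_le (by nlinarith) hμ.le
        _ = ((N₁ : ℝ) * k) ^ 2 := Real.rpow_two _
        _ ≤ ((N₁ : ℝ) * N₁) ^ 2 := by gcongr
        _ = _ := by ring
    have h3 : c / (N₁ : ℝ) ^ 4 ≤ c / ((N₁ : ℝ) * k) ^ μ := by gcongr
    have h4 : 1 / ((k : ℝ) * (n + 1)) < 1 / n := by
      apply one_div_lt_one_div_of_lt (by positivity)
      nlinarith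
    have h5 : c / (N₁ : ℝ) ^ 4 < 1 / n := by linarith
    rw [div_lt_div_iff₀ (by positivity) hn'] at h5
    rw [div_lt_iff₀ hc] at hn
    linarith

theorem two_le_muI (τ : ℝ) : ((2 : ℝ) : EReal) ≤ muI τ := by
  refine le_sInf ?_
  rintro _ ⟨μ, hμ, rfl⟩
  exact EReal.coe_le_coe_iff.2 (IsIrrExponent.two_le hμ)

theorem IsIrrExponent.irrational {τ μ : ℝ} (h : IsIrrExponent τ μ) : Irrational τ := by
  obtain ⟨c, hc, N₀, hN₀, h⟩ := h
  rintro ⟨x, rfl⟩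
  obtain ⟨l, hl⟩ := exists_nat_gt N₀
  have hd : (1 : ℝ) ≤ x.den := by exact_mod_cast x.den_pos
  have hl0 : (0 : ℝ) < l := hN₀.trans hl
  have h1 := h (l * x.num) (l * x.den) (by push_cast; nlinarith)
  push_cast at h1
  rw [mul_div_mul_left _ _ hl0.ne', ← Rat.cast_def, sub_self, abs_zero] at h1
  have : 0 < c / ((l : ℝ) * x.den) ^ μ := by positivity
  linarith

/-- An irrationality criterion: a sequence of linear forms `Q n * τ - P n` tending to zero such
that consecutive forms are independent. -/
theorem isIrrExponent_of_linear_forms {τ ν K : ℝ} (hν : 0 ≤ ν) (P Q : ℕ → ℤ) (E : ℕ → ℝ)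
    (hQ : ∀ n, 0 < Q n) (hdet : ∀ n, P (n + 1) * Q n ≠ P n * Q (n + 1))
    (hE : ∀ n, 0 < E n) (hE0 : Tendsto E atTop (nhds 0))
    (hPQ : ∀ n, |(Q n : ℝ) * τ - P n| ≤ E n)
    (h1 : ∀ n, (Q (n + 1) : ℝ) ≤ K * (E n) ^ (-ν))
    (h2 : ∀ n, (Q (n + 2) : ℝ) ≤ K * (E n) ^ (-ν)) :
    IsIrrExponent τ (ν + 1) := by
  have hK : 0 < K := by
    by_contra! hK
    have h3 : (0 : ℝ) < Q 1 := by exact_mod_cast hQ 1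
    have h4 := h1 0
    have h5 : K * (E 0) ^ (-ν) ≤ 0 :=
      mul_nonpos_of_nonpos_of_nonneg hK (Real.rpow_nonneg (hE 0).le _)
    simp only [zero_add] at h4
    linarith
  refine ⟨1 / (2 * K * 2 ^ ν), by positivity, 1 / E 0, one_div_pos.2 (hE 0), fun M N hN => ?_⟩
  have hN0 : (0 : ℝ) < N := (one_div_pos.2 (hE 0)).trans_le hN
  have hex : ∃ n, ∀ m, n ≤ m → E m ≤ 1 / (2 * N) := by
    obtain ⟨n, hn⟩ := eventually_atTop.1
      (hE0.eventually_le_const (show (0 : ℝ) < 1 / (2 * N) by positivity))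
    exact ⟨n, hn⟩
  obtain ⟨n, hn, hsm⟩ : ∃ n, 1 / (2 * N) < E n ∧ ∀ m, n + 1 ≤ m → E m ≤ 1 / (2 * N) := by
    classical
    have hspec := Nat.find_spec hex
    rcases hn0 : Nat.find hex with _ | n
    · rw [hn0] at hspec
      have h3 := hspec 0 le_rfl
      have h4 : 1 / E 0 ≤ N := hN
      rw [div_le_iff₀ (hE 0)] at h4
      rw [le_div_iff₀ (by positivity)] at h3
      nlinarith
    · rw [hn0] at hspec
      refine ⟨n, ?_, hspec⟩
      have h3 := Nat.find_min hex (show n < Nat.find hex by omega)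
      push Not at h3
      obtain ⟨m, hm, hm'⟩ := h3
      rcases hm.eq_or_lt with rfl | hlt
      · exact hm'
      · exact absurd (hspec m hlt) (not_le.2 hm')
  obtain ⟨k, hkn, hQk, hne⟩ : ∃ k, n + 1 ≤ k ∧ (Q k : ℝ) ≤ K * (E n) ^ (-ν) ∧
      P k * N - M * Q k ≠ 0 := by
    by_cases hz : P (n + 1) * N - M * Q (n + 1) = 0
    · refine ⟨n + 2, by omega, h2 n, fun hz' => hdet (n + 1) ?_⟩
      have hN1 : N ≠ 0 := by
        rintro rfl
        simp at hN0
      apply mul_left_cancel₀ hN1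
      linear_combination Q (n + 1) * hz' - Q (n + 2) * hz
    · exact ⟨n + 1, le_rfl, h1 n, hz⟩
  have hQ0 : (0 : ℝ) < Q k := by exact_mod_cast hQ k
  have hone : (1 : ℝ) ≤ |(P k : ℝ) * N - M * Q k| := by
    exact_mod_cast Int.one_le_abs hne
  have htri : |(P k : ℝ) * N - M * Q k| ≤ N * |Q k * τ - P k| + Q k * (N * |τ - M / N|) := by
    have h3 : (P k : ℝ) * N - M * Q k = -(N * (Q k * τ - P k)) + Q k * (N * (τ - M / N)) := by
      field_simp
      ring
    rw [h3]
    refine (abs_add_le _ _).trans (le_of_eq ?_)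
    rw [abs_neg, abs_mul, abs_mul, abs_mul, abs_of_pos hN0, abs_of_pos hQ0]
  have hhalf : N * |Q k * τ - P k| ≤ 1 / 2 := by
    have h3 := (hPQ k).trans (hsm k hkn)
    rw [le_div_iff₀ (by positivity)] at h3
    linarith
  have hEn : (E n) ^ (-ν) ≤ (2 * N) ^ ν := by
    have h3 : (1 / (2 * (N : ℝ))) ^ (-ν) = (2 * N) ^ ν := by
      rw [one_div, Real.inv_rpow (by positivity), Real.rpow_neg (by positivity), inv_inv]
    rw [← h3]
    exact Real.rpow_le_rpow_of_nonpos (by positivity) hn.le (by linarith)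
  have hQN : (Q k : ℝ) ≤ K * (2 ^ ν * (N : ℝ) ^ ν) := by
    rw [← Real.mul_rpow (by norm_num) hN0.le]
    exact hQk.trans (by gcongr)
  have hfin : 1 / 2 ≤ K * (2 ^ ν * (N : ℝ) ^ ν) * (N * |τ - M / N|) := by
    have h3 : 1 / 2 ≤ Q k * (N * |τ - M / N|) := by linarith
    exact h3.trans (by gcongr)
  rw [ge_iff_le, Real.rpow_add_one hN0.ne', div_div, div_le_iff₀ (by positivity)]
  linarith

/-- The case of linear forms whose coefficients and size are of the order of the exponential of
a quadratic polynomial. -/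
theorem isIrrExponent_of_exp_sq {τ ν L δ C : ℝ} (hL : 0 ≤ L) (hδ : 0 < δ) (hC : 0 ≤ C)
    (hν : L < ν * δ) (P Q : ℕ → ℤ)
    (hQ : ∀ n, 0 < Q n) (hdet : ∀ n, P (n + 1) * Q n ≠ P n * Q (n + 1))
    (hQle : ∀ n, (Q n : ℝ) ≤ Real.exp ((n + 1) ^ 2 / 4 * L + C * (n + 1)))
    (hPQ : ∀ n, |(Q n : ℝ) * τ - P n| ≤ Real.exp (-((n + 1) ^ 2 / 4 * δ) + C * (n + 1))) :
    IsIrrExponent τ (ν + 1) := by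
  have hν0 : 0 < ν := pos_of_mul_pos_left (hL.trans_lt hν) hδ.le
  have hquad : ∀ ε β x : ℝ, 0 < ε → β * x - ε * x ^ 2 ≤ β ^ 2 / (4 * ε) := by
    intro ε β x hε
    rw [le_div_iff₀ (by positivity)]
    nlinarith [sq_nonneg (β - 2 * ε * x)]
  set ε := (ν * δ - L) / 4 with hε
  have hε0 : 0 < ε := by rw [hε]; linarith
  set β := L + C + ν * C with hβ
  have key : ∀ n : ℕ, (n + 3 : ℝ) ^ 2 / 4 * L + C * (n + 3) ≤
      (β ^ 2 / (4 * ε) + L + 2 * C) +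
        (-((n + 1 : ℝ) ^ 2 / 4 * δ) + C * (n + 1)) * (-ν) := by
    intro n
    have := hquad ε β (n + 1) hε0
    rw [hβ, hε] at this ⊢
    nlinarith
  have hrpow : ∀ x K : ℝ, Real.exp K * (Real.exp x) ^ (-ν) = Real.exp (K + x * (-ν)) := by
    intro x K
    rw [← Real.exp_mul, ← Real.exp_add]
  refine isIrrExponent_of_linear_forms (K := Real.exp (β ^ 2 / (4 * ε) + L + 2 * C)) hν0.le P Q
    (fun n => Real.exp (-((n + 1) ^ 2 / 4 * δ) + C * (n + 1))) hQ hdet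
    (fun n => Real.exp_pos _) ?_ hPQ ?_ ?_
  · refine Real.tendsto_exp_atBot.comp ?_
    have hb : ∀ n : ℕ, -((n + 1 : ℝ) ^ 2 / 4 * δ) + C * (n + 1) ≤
        (C + 1) ^ 2 / (4 * (δ / 4)) + -(n : ℝ) := by
      intro n
      have := hquad (δ / 4) (C + 1) (n + 1) (by positivity)
      nlinarith
    exact tendsto_atBot_mono hb (tendsto_atBot_add_const_left _ _
      (tendsto_neg_atTop_atBot.comp tendsto_natCast_atTop_atTop))
  · intro n
    rw [hrpow]
    refine (hQle (n + 1)).trans (Real.exp_le_exp.2 (le_trans ?_ (key n)))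
    push_cast
    have hn : (0 : ℝ) ≤ n := n.cast_nonneg
    have h3 : (n + 1 + 1 : ℝ) ≤ n + 3 := by linarith
    gcongr
  · intro n
    rw [hrpow]
    refine (hQle (n + 2)).trans (Real.exp_le_exp.2 (le_trans (le_of_eq ?_) (key n)))
    push_cast
    ring

/-- The product `∏_{i=1}^n (q ^ i * t)` of the partial numerators. -/
def rrProd (q t : ℝ) (n : ℕ) : ℝ := ∏ i ∈ Finset.range n, q ^ (i + 1) * t

theorem rrProd_succ (q t : ℝ) (n : ℕ) : rrProd q t (n + 1) = rrProd q t n * (q ^ (n + 1) * t) :=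
  Finset.prod_range_succ _ _

theorem rrProd_pos {q t : ℝ} (hq : 0 < q) (ht : 0 < t) (n : ℕ) : 0 < rrProd q t n :=
  Finset.prod_pos fun _ _ => by positivity

theorem rrProd_add_le {q t : ℝ} (hq : 0 < q) (hq1 : q ≤ 1) (ht : 0 < t) (n j : ℕ) :
    rrProd q t (n + j) ≤ rrProd q t n * rrProd q t j := by
  induction j with
  | zero => simp [rrProd]
  | succ j ih =>
    rw [← add_assoc, rrProd_succ, rrProd_succ]
    have h1 : q ^ (n + j + 1) ≤ q ^ (j + 1) :=
      pow_le_pow_of_le_one hq.le hq1 (by omega)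
    have h2 := rrProd_pos hq ht n
    have h3 := rrProd_pos hq ht j
    rw [← mul_assoc (rrProd q t n)]
    exact mul_le_mul ih (by gcongr) (by positivity) (by positivity)

theorem summable_rrProd {q t : ℝ} (hq : 0 < q) (hq1 : q < 1) (ht : 0 < t) :
    Summable (rrProd q t) := by
  refine summable_of_ratio_test_tendsto_lt_one (l := 0) one_pos
    (Eventually.of_forall fun n => (rrProd_pos hq ht n).ne') ?_
  have h : ∀ n, ‖rrProd q t (n + 1)‖ / ‖rrProd q t n‖ = q ^ (n + 1) * t := by
    intro n
    have := rrProd_pos hq ht n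
    rw [Real.norm_of_nonneg (rrProd_pos hq ht _).le, Real.norm_of_nonneg this.le, rrProd_succ]
    field_simp
  simp only [h]
  simpa using ((tendsto_pow_atTop_nhds_zero_of_lt_one hq.le hq1).comp
    (tendsto_add_atTop_nat 1)).mul_const t

theorem rrProd_le_exp {q t x y : ℝ} (hq : q = Real.exp (-x)) (hx : 0 ≤ x) (ht : 0 < t)
    (hty : t ≤ Real.exp y) (n : ℕ) :
    rrProd q t n ≤ Real.exp (-((n : ℝ) ^ 2 / 2 * x) + n * y) := by
  induction n with
  | zero => simp [rrProd]
  | succ n ih =>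
    have hq0 : 0 < q := hq ▸ Real.exp_pos _
    rw [rrProd_succ]
    calc rrProd q t n * (q ^ (n + 1) * t)
        ≤ Real.exp (-((n : ℝ) ^ 2 / 2 * x) + n * y) *
            (Real.exp ((n + 1 : ℕ) * (-x)) * Real.exp y) := by
          rw [Real.exp_nat_mul, ← hq]
          gcongr
      _ = Real.exp (-((n : ℝ) ^ 2 / 2 * x) + n * y + ((n + 1 : ℕ) * (-x) + y)) := by
          rw [← Real.exp_add, ← Real.exp_add]
      _ ≤ _ := by
          apply Real.exp_le_exp.2
          push_cast
          nlinarith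

/-- The three-term recurrence satisfied by the numerators and denominators of the convergents of
the Rogers–Ramanujan continued fraction. -/
def RRRec (q t : ℝ) (X : ℕ → ℝ) : Prop :=
  ∀ n, X (n + 2) = X (n + 1) + q ^ (n + 2) * t * X n

theorem RRRec.det {q t : ℝ} {A B : ℕ → ℝ} (hA : RRRec q t A) (hB : RRRec q t B)
    (hA0 : A 0 = 0) (hA1 : A 1 = q * t) (hB0 : B 0 = 1) (n : ℕ) :
    A (n + 1) * B n - A n * B (n + 1) = (-1) ^ n * rrProd q t (n + 1) := by
  induction n with
  | zero => simp [rrProd, hA0, hA1, hB0]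
  | succ n ih =>
    rw [hA n, hB n, rrProd_succ q t (n + 1), pow_succ]
    linear_combination (-q ^ (n + 2) * t) * ih

theorem RRRec.one_le_and_mono {q t : ℝ} {B : ℕ → ℝ} (hB : RRRec q t B) (hq : 0 < q) (ht : 0 < t)
    (hB0 : B 0 = 1) (hB1 : B 1 = 1) (n : ℕ) : 1 ≤ B n ∧ B n ≤ B (n + 1) := by
  induction n with
  | zero => simp [hB0, hB1]
  | succ n ih =>
    refine ⟨ih.1.trans ih.2, ?_⟩
    rw [hB n]
    have : 0 ≤ q ^ (n + 2) * t * B n := mul_nonneg (by positivity) (by linarith [ih.1])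
    linarith

theorem RRRec.le_pow {q t : ℝ} {B : ℕ → ℝ} (hB : RRRec q t B) (hq : 0 < q) (hq1 : q ≤ 1)
    (ht : 0 < t) (hB0 : B 0 = 1) (hB1 : B 1 = 1) (n : ℕ) : B n ≤ (1 + t) ^ n := by
  induction n with
  | zero => simp [hB0]
  | succ n ih =>
    rcases n with _ | n
    · simp [hB1, ht.le]
    · obtain ⟨h1, h2⟩ := hB.one_le_and_mono hq ht hB0 hB1 n
      rw [hB n, pow_succ (1 + t)]
      have h3 : q ^ (n + 2) ≤ 1 := pow_le_one₀ hq.le hq1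
      have h4 : q ^ (n + 2) * t * B n ≤ 1 * t * B (n + 1) := by gcongr
      calc _ ≤ B (n + 1) * (1 + t) := by linarith
        _ ≤ _ := mul_le_mul_of_nonneg_right ih (by linarith)

theorem RRRec.exists_int {a b r s : ℕ} (hb : 1 ≤ b) (hs : 1 ≤ s) {X : ℕ → ℝ}
    (hX : RRRec ((a : ℝ) / b) ((r : ℝ) / s) X) (h0 : ∃ z : ℤ, (z : ℝ) = X 0)
    (h1 : ∃ z : ℤ, (z : ℝ) = b * s * X 1) (n : ℕ) :
    ∃ z : ℤ, (z : ℝ) = (b : ℝ) ^ ((n + 1) ^ 2 / 4) * (s : ℝ) ^ n * X n := by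
  induction n using Nat.twoStepInduction with
  | zero => simpa using h0
  | one => simpa using h1
  | more n ih0 ih1 =>
    obtain ⟨x, hx⟩ := ih0
    obtain ⟨y, hy⟩ := ih1
    have hb' : (b : ℝ) ≠ 0 := by positivity
    have hs' : (s : ℝ) ≠ 0 := by positivity
    have he : (n + 2 + 1) ^ 2 / 4 = (n + 1) ^ 2 / 4 + (n + 2) := by
      have : (n + 2 + 1) ^ 2 = (n + 1) ^ 2 + 4 * (n + 2) := by ring
      omega
    obtain ⟨d, hd⟩ : ∃ d, (n + 2 + 1) ^ 2 / 4 = (n + 1 + 1) ^ 2 / 4 + d :=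
      Nat.exists_eq_add_of_le (Nat.div_le_div_right (Nat.pow_le_pow_left (by omega) 2))
    refine ⟨b ^ d * s * y + a ^ (n + 2) * r * s * x, ?_⟩
    push_cast
    rw [hx, hy, hX n, mul_add]
    congr 1
    · rw [hd]
      ring
    · rw [he, div_pow]
      field_simp
      ring

theorem RRRec.exists_tendsto {q t : ℝ} {A B : ℕ → ℝ} (hA : RRRec q t A) (hB : RRRec q t B)
    (hq : 0 < q) (hq1 : q < 1) (ht : 0 < t)
    (hA0 : A 0 = 0) (hA1 : A 1 = q * t) (hB0 : B 0 = 1) (hB1 : B 1 = 1) :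
    ∃ τ, Tendsto (fun n => A n / B n) atTop (nhds τ) ∧
      ∀ n, |τ - A n / B n| ≤ rrProd q t (n + 1) * ∑' j, rrProd q t j := by
  have hBpos : ∀ n, 1 ≤ B n := fun n => (hB.one_le_and_mono hq ht hB0 hB1 n).1
  have hsum := summable_rrProd hq hq1 ht
  have hsum1 : Summable fun n => rrProd q t (n + 1) := (summable_nat_add_iff 1).2 hsum
  have hdist : ∀ n, dist (A n / B n) (A (n + 1) / B (n + 1)) ≤ rrProd q t (n + 1) := by
    intro n
    have h1 := hBpos n
    have h2 := hBpos (n + 1)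
    have h3 := rrProd_pos hq ht (n + 1)
    have h4 : A (n + 1) / B (n + 1) - A n / B n =
        (-1) ^ n * rrProd q t (n + 1) / (B (n + 1) * B n) := by
      rw [← hA.det hB hA0 hA1 hB0 n, div_sub_div _ _ (by linarith) (by linarith)]
      ring
    rw [dist_comm, Real.dist_eq, h4, abs_div, abs_mul, abs_pow, abs_neg, abs_one, one_pow, one_mul,
      abs_of_pos h3, abs_of_pos (by nlinarith)]
    exact div_le_self h3.le (by nlinarith)
  obtain ⟨τ, hτ⟩ := cauchySeq_tendsto_of_complete (cauchySeq_of_dist_le_of_summable _ hdist hsum1)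
  refine ⟨τ, hτ, fun n => ?_⟩
  have h1 := dist_le_tsum_of_dist_le_of_tendsto _ hdist hsum1 hτ n
  rw [dist_comm, Real.dist_eq] at h1
  refine h1.trans ?_
  rw [← tsum_mul_left]
  refine Summable.tsum_le_tsum (fun j => ?_) ?_ (hsum.mul_left _)
  · have := rrProd_add_le hq hq1.le ht (n + 1) j
    rwa [show n + 1 + j = n + j + 1 by ring] at this
  · exact (summable_nat_add_iff (f := fun m => rrProd q t (m + 1)) n).2 hsum1 |>.congr
      fun j => by congr 1; ring

theorem rogers_ramanujan_isIrrExponent {a b r s : ℕ} (ha : 1 ≤ a) (hb : 1 ≤ b) (hr : 1 ≤ r)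
    (hs : 1 ≤ s) (hab : a ^ 2 < b) {A B : ℕ → ℝ}
    (hA : RRRec ((a : ℝ) / b) ((r : ℝ) / s) A) (hB : RRRec ((a : ℝ) / b) ((r : ℝ) / s) B)
    (hA0 : A 0 = 0) (hA1 : A 1 = (a : ℝ) / b * ((r : ℝ) / s)) (hB0 : B 0 = 1) (hB1 : B 1 = 1) :
    ∃ τ, Tendsto (fun n => A n / B n) atTop (nhds τ) ∧
      ∀ μ : ℝ, 2 + 2 * Real.log a / (Real.log b - 2 * Real.log a) < μ → IsIrrExponent τ μ := by
  have ha' : (1 : ℝ) ≤ a := by exact_mod_cast ha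
  have hb' : (1 : ℝ) ≤ b := by exact_mod_cast hb
  have hr' : (1 : ℝ) ≤ r := by exact_mod_cast hr
  have hs' : (1 : ℝ) ≤ s := by exact_mod_cast hs
  have hb0 : (0 : ℝ) < b := by linarith
  have hab' : (a : ℝ) ^ 2 < b := by exact_mod_cast hab
  set q : ℝ := (a : ℝ) / b with hq_def
  set t : ℝ := (r : ℝ) / s with ht_def
  have hq : 0 < q := by positivity
  have ht : 0 < t := by positivity
  have hq1 : q < 1 := by
    rw [hq_def, div_lt_one hb0]
    nlinarith
  have hla : 0 ≤ Real.log a := Real.log_nonneg ha'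
  have hδ : 0 < Real.log b - 2 * Real.log a := by
    have := Real.log_lt_log (by positivity) hab'
    rw [Real.log_pow] at this
    push_cast at this
    linarith
  set L := Real.log b with hL_def
  have hL : 0 < L := by linarith
  obtain ⟨τ, hτ, happ⟩ := hA.exists_tendsto hB hq hq1 ht hA0 hA1 hB0 hB1
  refine ⟨τ, hτ, fun μ hμ => ?_⟩
  have hBpos : ∀ n, 1 ≤ B n := fun n => (hB.one_le_and_mono hq ht hB0 hB1 n).1
  choose P hP using hA.exists_int hb hs ⟨0, by simp [hA0]⟩
    ⟨a * r, by rw [hA1, hq_def, ht_def]; push_cast; field_simp⟩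
  choose Q hQ using hB.exists_int hb hs ⟨1, by simp [hB0]⟩ ⟨b * s, by simp [hB1]⟩
  have hD : ∀ n : ℕ, 0 < (b : ℝ) ^ ((n + 1) ^ 2 / 4) * (s : ℝ) ^ n := fun n => by positivity
  set S := ∑' j, rrProd q t j
  have hS : 1 ≤ S := by
    have := (summable_rrProd hq hq1 ht).le_tsum 0 (fun j _ => (rrProd_pos hq ht j).le)
    exact (show (1 : ℝ) = rrProd q t 0 by simp [rrProd]).trans_le this
  set C := Real.log (1 + t) + Real.log s + Real.log S with hC_def
  have hlt : 0 ≤ Real.log (1 + t) := Real.log_nonneg (by linarith)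
  have hls : 0 ≤ Real.log s := Real.log_nonneg hs'
  have hlS : 0 ≤ Real.log S := Real.log_nonneg hS
  have hC : 0 ≤ C := by linarith
  have htC : 1 + t ≤ Real.exp C := by
    rw [← Real.log_le_iff_le_exp (by positivity)]
    linarith
  have hsC : (s : ℝ) ≤ Real.exp C := by
    rw [← Real.log_le_iff_le_exp (by positivity)]
    linarith
  have hSC : S ≤ Real.exp C := by
    rw [← Real.log_le_iff_le_exp (by positivity)]
    linarith
  have hQpos : ∀ n, (0 : ℝ) < Q n := by
    intro n
    rw [hQ]
    exact mul_pos (hD n) (by linarith [hBpos n])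
  have hQle : ∀ n : ℕ, (Q n : ℝ) ≤ Real.exp ((n + 1) ^ 2 / 4 * L + 2 * C * n) := by
    intro n
    have h1 : (b : ℝ) ^ ((n + 1) ^ 2 / 4) ≤ Real.exp ((n + 1) ^ 2 / 4 * L) := by
      rw [← Real.exp_log (show (0 : ℝ) < (b : ℝ) ^ ((n + 1) ^ 2 / 4) by positivity),
        Real.log_pow]
      apply Real.exp_le_exp.2
      have : (((n + 1) ^ 2 / 4 : ℕ) : ℝ) ≤ (n + 1) ^ 2 / 4 := by
        refine Nat.cast_div_le.trans (le_of_eq ?_)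
        push_cast
        rfl
      gcongr
    have h2 : (s : ℝ) ^ n ≤ Real.exp (n * C) := by
      rw [Real.exp_nat_mul]
      gcongr
    have h3 : B n ≤ Real.exp (n * C) := by
      rw [Real.exp_nat_mul]
      exact (hB.le_pow hq hq1.le ht hB0 hB1 n).trans (by gcongr)
    rw [hQ]
    calc _ ≤ Real.exp ((n + 1) ^ 2 / 4 * L) * Real.exp (n * C) * Real.exp (n * C) := by
          have := hBpos n
          gcongr
      _ = _ := by
          rw [← Real.exp_add, ← Real.exp_add]
          ring_nf
  have hμ' : L < (μ - 1) * (L - 2 * Real.log a) := by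
    have h1 : 2 + 2 * Real.log a / (L - 2 * Real.log a) =
        1 + L / (L - 2 * Real.log a) := by
      field_simp
      ring
    rw [h1] at hμ
    rw [← div_lt_iff₀ hδ]
    linarith
  have hexp_q : q = Real.exp (-(L - Real.log a)) := by
    rw [neg_sub, Real.exp_sub, Real.exp_log (by positivity), Real.exp_log hb0]
  have := isIrrExponent_of_exp_sq (τ := τ) (C := 4 * C) hL.le hδ (by positivity) hμ' P Q
    (fun n => by exact_mod_cast hQpos n) ?_ ?_ ?_
  · simpa using this
  · intro n hn
    have h1 : (P (n + 1) : ℝ) * Q n = P n * Q (n + 1) := by exact_mod_cast hn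
    rw [hP, hP, hQ, hQ] at h1
    have h2 := hA.det hB hA0 hA1 hB0 n
    have h3 : A (n + 1) * B n - A n * B (n + 1) = 0 := by
      apply mul_left_cancel₀ (mul_pos (hD (n + 1)) (hD n)).ne'
      linear_combination h1
    rw [h3] at h2
    exact mul_ne_zero (pow_ne_zero n (by norm_num)) (rrProd_pos hq ht (n + 1)).ne' h2.symm
  · intro n
    refine (hQle n).trans (Real.exp_le_exp.2 ?_)
    nlinarith [mul_nonneg hC (n.cast_nonneg : (0 : ℝ) ≤ n)]
  · intro n
    have h1 : (Q n : ℝ) * τ - P n = Q n * (τ - A n / B n) := by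
      have := hBpos n
      have hB' : B n ≠ 0 := by linarith
      rw [hP, hQ]
      field_simp
    have h2 := rrProd_le_exp hexp_q (by linarith) ht (show t ≤ Real.exp C by linarith) (n + 1)
    have h3 := rrProd_pos hq ht (n + 1)
    rw [h1, abs_mul, abs_of_pos (hQpos n)]
    calc (Q n : ℝ) * |τ - A n / B n| ≤ Q n * (rrProd q t (n + 1) * S) := by
          have := hQpos n
          gcongr
          exact happ n
      _ ≤ Real.exp ((n + 1) ^ 2 / 4 * L + 2 * C * n) *
          (Real.exp (-(((n + 1 : ℕ) : ℝ) ^ 2 / 2 * (L - Real.log a)) + (n + 1 : ℕ) * C) *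
            Real.exp C) := by
          have := hQle n
          gcongr
      _ ≤ _ := by
          rw [← Real.exp_add, ← Real.exp_add]
          apply Real.exp_le_exp.2
          push_cast
          nlinarith [mul_nonneg hC (n.cast_nonneg : (0 : ℝ) ≤ n)]

/-- the Rogers–Ramanujan continued fraction
`RR(q,t) = K_{n=1}^∞ (q^n t)/1` with `q = a/b`, `t = r/s`, `a² < b` converges to
an irrational number with `μ_I ≤ 2 + 2 log a / (log b - 2 log a)`; in
particular `μ_I = 2` when `a = 1`. -/
theorem rogers_ramanujan_muI_le
    (a b r s : ℕ) (ha : 1 ≤ a) (hb : 1 ≤ b) (hr : 1 ≤ r) (hs : 1 ≤ s)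
    (hab : a ^ 2 < b) :
    ∃ τ : ℝ,
      Tendsto (fun n =>
          ((cfAQ (fun n => ((a : ℚ) / (b : ℚ)) ^ n * ((r : ℚ) / (s : ℚ))) (fun _ => 1) n : ℝ) /
           (cfBQ (fun n => ((a : ℚ) / (b : ℚ)) ^ n * ((r : ℚ) / (s : ℚ))) (fun _ => 1) n : ℝ)))
        atTop (nhds τ) ∧
      Irrational τ ∧
      muI τ ≤ ((2 + 2 * Real.log (a : ℝ) / (Real.log (b : ℝ) - 2 * Real.log (a : ℝ)) : ℝ) : EReal) ∧
      (a = 1 → muI τ = ((2 : ℝ) : EReal)) := by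
  have hrec : ∀ X : ℕ → ℚ, (∀ n, X (n + 2) = 1 * X (n + 1) +
      ((a : ℚ) / (b : ℚ)) ^ (n + 2) * ((r : ℚ) / (s : ℚ)) * X n) →
      RRRec ((a : ℝ) / b) ((r : ℝ) / s) (fun n => (X n : ℝ)) := by
    intro X hX n
    simp only [hX n]
    push_cast
    ring
  obtain ⟨τ, hτ, h⟩ := rogers_ramanujan_isIrrExponent ha hb hr hs hab
    (hrec (cfAQ (fun n => ((a : ℚ) / (b : ℚ)) ^ n * ((r : ℚ) / (s : ℚ))) (fun _ => 1))
      fun n => rfl)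
    (hrec (cfBQ (fun n => ((a : ℚ) / (b : ℚ)) ^ n * ((r : ℚ) / (s : ℚ))) (fun _ => 1))
      fun n => rfl)
    (by simp [cfAQ]) (by simp [cfAQ]) (by simp [cfBQ]) (by simp [cfBQ])
  have hle := muI_le_of_forall_gt h
  refine ⟨τ, hτ, (h _ (lt_add_one _)).irrational, hle, ?_⟩
  rintro rfl
  refine le_antisymm ?_ (two_le_muI τ)
  simpa using hle
end

section
/- Let a, b be positive integers with a² < b and set q = a/b. Then the continued fraction M(q) = K_{n=1}^∞ q^{2n}/(1 + q^n), with partial numerators a_n = q^{2n} and partial denominators b_n = 1 + q^n, converges to an irrational number, and μ_I(M(q)) ≤ 2 + (2 log a)/(log b − 2 log a). -/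
open Filter

/-- Irrationality measure criterion: integer approximations `P n / Q n` to `τ` with
`Q n ≤ exp (u n)` and `|Q n * τ - P n| ≤ exp (-e n) / 2`, consecutive ones being distinct. -/
theorem exists_lower_bound_of_approximations {τ μ : ℝ} (hμ : 1 ≤ μ) (P Q : ℕ → ℤ) (e u : ℕ → ℝ)
    (hQ : ∀ n, 0 < Q n) (hQu : ∀ n, (Q n : ℝ) ≤ Real.exp (u n))
    (happ : ∀ n, |(Q n : ℝ) * τ - P n| ≤ Real.exp (-e n) / 2)
    (hne : ∀ n, P (n + 1) * Q n ≠ P n * Q (n + 1))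
    (he : Tendsto e atTop atTop)
    (hu₁ : ∀ᶠ n in atTop, u (n + 1) ≤ (μ - 1) * e n)
    (hu₂ : ∀ᶠ n in atTop, u (n + 2) ≤ (μ - 1) * e n) :
    ∃ c > (0:ℝ), ∃ N₀ > (0:ℝ), ∀ M N : ℤ,
      (N : ℝ) ≥ N₀ → |τ - (M : ℝ) / (N : ℝ)| ≥ c / (N : ℝ) ^ μ := by
  classical
  obtain ⟨n₀, hn₀⟩ := eventually_atTop.1 (hu₁.and hu₂)
  refine ⟨1 / 2, by norm_num, Real.exp (e n₀) + 1, by positivity, fun M N hN => ?_⟩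
  have hNpos : (0 : ℝ) < N := lt_of_lt_of_le (by positivity) hN
  have hex : ∃ m, ∀ j ≥ m, Real.log N ≤ e j :=
    eventually_atTop.1 (he.eventually_ge_atTop (Real.log N))
  set m := Nat.find hex
  have hspec : ∀ j ≥ m, Real.log N ≤ e j := Nat.find_spec hex
  have hlog : e n₀ < Real.log N := by
    rw [Real.lt_log_iff_exp_lt hNpos]; linarith
  have hlt : n₀ < m := by
    by_contra! h
    exact absurd (hspec n₀ h) (not_le.2 hlog)
  obtain ⟨k, hk⟩ : ∃ k, m = k + 1 := ⟨m - 1, by omega⟩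
  have hek : e k < Real.log N := by
    have h := Nat.find_min hex (m := k) (by omega)
    push Not at h
    obtain ⟨j, hj, hj'⟩ := h
    rcases hj.eq_or_lt with rfl | h
    · exact hj'
    · exact absurd (hspec j (by omega)) (not_le.2 hj')
  have key : ∀ j ≥ m, u j ≤ (μ - 1) * e k → M * Q j ≠ P j * N →
      |τ - (M : ℝ) / (N : ℝ)| ≥ (1 / 2) / (N : ℝ) ^ μ := by
    intro j hj huj hMj
    have hQj : (0 : ℝ) < Q j := by exact_mod_cast hQ j
    have h1 : (1 : ℝ) ≤ |(M : ℝ) * Q j - P j * N| := by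
      exact_mod_cast Int.one_le_abs (sub_ne_zero.2 hMj)
    have h2 : (N : ℝ) * |(Q j : ℝ) * τ - P j| ≤ 1 / 2 := by
      have h3 : Real.exp (-e j) ≤ (N : ℝ)⁻¹ := by
        rw [← Real.exp_log (inv_pos.2 hNpos), Real.log_inv]
        exact Real.exp_le_exp.2 (neg_le_neg (hspec j hj))
      calc (N : ℝ) * |(Q j : ℝ) * τ - P j| ≤ N * ((N : ℝ)⁻¹ / 2) := by
            gcongr
            exact (happ j).trans (by linarith)
        _ = 1 / 2 := by field_simp
    have h4 : (1 : ℝ) / 2 ≤ Q j * (N * |τ - (M : ℝ) / N|) := by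
      have h5 : (M : ℝ) * Q j - P j * N
          = N * (Q j * τ - P j) - Q j * (N * (τ - (M : ℝ) / N)) := by
        field_simp; ring
      have h6 := abs_sub ((N : ℝ) * (Q j * τ - P j)) (Q j * (N * (τ - (M : ℝ) / N)))
      rw [← h5, abs_mul, abs_mul, abs_mul, abs_of_pos hNpos, abs_of_pos hQj] at h6
      linarith
    have h7 : (Q j : ℝ) ≤ (N : ℝ) ^ (μ - 1) := by
      refine (hQu j).trans ?_
      rw [Real.rpow_def_of_pos hNpos]
      apply Real.exp_le_exp.2
      nlinarith
    rw [ge_iff_le, div_le_iff₀ (Real.rpow_pos_of_pos hNpos _)]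
    have h8 : (N : ℝ) ^ μ = (N : ℝ) ^ (μ - 1) * N := by
      rw [← Real.rpow_add_one hNpos.ne']; congr 1; ring
    rw [h8]
    calc (1 : ℝ) / 2 ≤ Q j * (N * |τ - (M : ℝ) / N|) := h4
      _ ≤ (N : ℝ) ^ (μ - 1) * (N * |τ - (M : ℝ) / N|) := by gcongr
      _ = _ := by ring
  obtain ⟨h1, h2⟩ := hn₀ k (by omega)
  by_cases hc : M * Q (k + 1) = P (k + 1) * N
  · refine key (k + 2) (by omega) h2 fun hc' => hne (k + 1) ?_
    have hN0 : N ≠ 0 := by exact_mod_cast hNpos.ne'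
    apply mul_right_cancel₀ hN0
    linear_combination Q (k + 2) * hc - Q (k + 1) * hc'
  · exact key (k + 1) (by omega) h1 hc

/-- A rational number admits no uniform lower bound of the form `c / N ^ μ`. -/
theorem irrational_of_lower_bound {τ μ : ℝ}
    (h : ∃ c > (0:ℝ), ∃ N₀ > (0:ℝ), ∀ M N : ℤ,
      (N : ℝ) ≥ N₀ → |τ - (M : ℝ) / (N : ℝ)| ≥ c / (N : ℝ) ^ μ) : Irrational τ := by
  rintro ⟨r, rfl⟩
  obtain ⟨c, hc, N₀, hN₀, h⟩ := h
  obtain ⟨k, hk⟩ := exists_nat_ge N₀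
  have hkpos : (0 : ℝ) < k := lt_of_lt_of_le hN₀ hk
  have hden : (1 : ℝ) ≤ r.den := by exact_mod_cast r.pos
  have hle : N₀ ≤ (k : ℝ) * r.den := hk.trans (le_mul_of_one_le_right hkpos.le hden)
  have h1 := h (k * r.num) (k * r.den) (by push_cast; exact hle)
  have hr : ((r : ℝ)) = (r.num : ℝ) / r.den := by exact_mod_cast (Rat.num_div_den r).symm
  have h0 : (r : ℝ) - ((k * r.num : ℤ) : ℝ) / ((k * r.den : ℤ) : ℝ) = 0 := by
    rw [hr]; push_cast; field_simp; ring
  rw [h0, abs_zero] at h1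
  have h2 : (0 : ℝ) < ((k * r.den : ℤ) : ℝ) := by push_cast; positivity
  have h3 : 0 < c / ((k * r.den : ℤ) : ℝ) ^ μ := div_pos hc (Real.rpow_pos_of_pos h2 _)
  linarith

theorem muI_le_of_forall_gt_s15 {τ μ₀ : ℝ}
    (h : ∀ μ > μ₀, ∃ c > (0:ℝ), ∃ N₀ > (0:ℝ), ∀ M N : ℤ,
      (N : ℝ) ≥ N₀ → |τ - (M : ℝ) / (N : ℝ)| ≥ c / (N : ℝ) ^ μ) : muI τ ≤ (μ₀ : EReal) := by
  refine EReal.le_of_forall_lt_iff_le.1 fun μ hμ => ?_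
  exact sInf_le ⟨μ, h μ (by exact_mod_cast hμ), rfl⟩

theorem tendsto_quadratic_atTop {A : ℝ} (hA : 0 < A) (B C : ℝ) :
    Tendsto (fun n : ℕ => A * (n : ℝ) ^ 2 + B * n + C) atTop atTop := by
  have h1 : Tendsto (fun n : ℕ => A * (n : ℝ) + B) atTop atTop :=
    tendsto_atTop_add_const_right _ _
      (Tendsto.const_mul_atTop hA tendsto_natCast_atTop_atTop)
  have h2 := tendsto_atTop_add_const_right _ C (h1.atTop_mul_atTop₀ tendsto_natCast_atTop_atTop)
  refine h2.congr fun n => ?_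
  ring

/-- Clearing denominators in solutions of `x (n+2) = (1 + q^(n+2)) x (n+1) + q^(2(n+2)) x n`. -/
theorem exists_int_eq_mul_pow {a b : ℕ} (hb : b ≠ 0) {x : ℕ → ℚ}
    (h0 : ∃ z : ℤ, x 0 = z) (h1 : ∃ z : ℤ, x 1 * (b : ℚ) ^ 2 = z)
    (hrec : ∀ n, x (n + 2) = (1 + ((a : ℚ) / b) ^ (n + 2)) * x (n + 1)
      + ((a : ℚ) / b) ^ (2 * (n + 2)) * x n)
    {s : ℕ → ℕ} (hs0 : s 0 = 0) (hs : ∀ n, s (n + 1) = s n + (n + 2)) (n : ℕ) :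
    ∃ z : ℤ, x n * (b : ℚ) ^ s n = z := by
  have hb' : (b : ℚ) ≠ 0 := by exact_mod_cast hb
  induction n using Nat.twoStepInduction with
  | zero => simpa [hs0] using h0
  | one => simpa [hs, hs0] using h1
  | more n ih1 ih2 =>
    obtain ⟨y, hy⟩ := ih1
    obtain ⟨z, hz⟩ := ih2
    refine ⟨(b ^ (n + 3) + a ^ (n + 2) * b) * z + a ^ (2 * (n + 2)) * b * y, ?_⟩
    push_cast
    rw [← hy, ← hz, hrec, hs (n + 1), hs n, div_pow, div_pow]
    have e1 : (b : ℚ) ^ (s n + (n + 2) + (n + 1 + 2)) =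
      b ^ s n * b ^ (n + 2) * b ^ (n + 2) * b := by ring
    have e2 : (b : ℚ) ^ (2 * (n + 2)) = b ^ (n + 2) * b ^ (n + 2) := by ring
    have e3 : (b : ℚ) ^ (s n + (n + 2)) = b ^ s n * b ^ (n + 2) := by ring
    have e4 : (b : ℚ) ^ (n + 3) = b ^ (n + 2) * b := by ring
    rw [e1, e2, e3, e4]
    have : (b : ℚ) ^ (n + 2) ≠ 0 := pow_ne_zero _ hb'
    generalize (b : ℚ) ^ (n + 2) = w at *
    field_simp

theorem cfBQ_bounds {α β : ℕ → ℚ} (hα : ∀ n, 0 ≤ α n) (hα' : ∀ n, α n ≤ 1)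
    (hβ : ∀ n, 1 ≤ n → 1 ≤ β n) (hβ' : ∀ n, 1 ≤ n → β n ≤ 2) (n : ℕ) :
    1 ≤ cfBQ α β n ∧ cfBQ α β n ≤ cfBQ α β (n + 1) ∧ cfBQ α β (n + 1) ≤ 3 * cfBQ α β n := by
  induction n with
  | zero =>
    have h1 := hβ 1 le_rfl
    have h2 := hβ' 1 le_rfl
    simp only [cfBQ]
    refine ⟨le_rfl, h1, by linarith⟩
  | succ n ih =>
    obtain ⟨h1, h2, h3⟩ := ih
    have h4 := hβ (n + 2) (by omega)
    have h5 := hβ' (n + 2) (by omega)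
    have h6 := hα (n + 2)
    have h7 := hα' (n + 2)
    simp only [cfBQ]
    refine ⟨h1.trans h2, ?_, ?_⟩ <;> nlinarith

theorem cf_determinant (α β : ℕ → ℚ) (n : ℕ) :
    cfAQ α β (n + 1) * cfBQ α β n - cfAQ α β n * cfBQ α β (n + 1)
      = (-1) ^ n * ∏ k ∈ Finset.range (n + 1), α (k + 1) := by
  induction n with
  | zero => simp [cfAQ, cfBQ]
  | succ n ih =>
    rw [Finset.prod_range_succ, pow_succ]
    simp only [cfAQ, cfBQ]
    linear_combination (-α (n + 2)) * ih

theorem prod_range_pow_two_mul (q : ℚ) (n : ℕ) :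
    ∏ k ∈ Finset.range (n + 1), q ^ (2 * (k + 1)) = q ^ ((n + 1) * (n + 2)) := by
  induction n with
  | zero => simp
  | succ n ih => rw [Finset.prod_range_succ, ih, ← pow_add]; congr 1; ring

/-- A sequence with steps bounded by `r ^ ((n+1)(n+2))`, `r ≤ 1/2`, converges, with tail at most
twice the next step bound. -/
theorem exists_tendsto_of_abs_step_le {f : ℕ → ℝ} {r : ℝ} (hr0 : 0 ≤ r) (hr : r ≤ 1 / 2)
    (hf : ∀ n, |f (n + 1) - f n| ≤ r ^ ((n + 1) * (n + 2))) :
    ∃ τ, Tendsto f atTop (nhds τ) ∧ ∀ n, |τ - f n| ≤ 2 * r ^ ((n + 1) * (n + 2)) := by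
  have hr1 : r < 1 := by linarith
  have step : ∀ n m, dist (f (m + n)) (f (m + 1 + n)) ≤ r ^ ((n + 1) * (n + 2)) * r ^ m := by
    intro n m
    rw [dist_comm, Real.dist_eq, ← pow_add, show m + 1 + n = m + n + 1 by ring]
    exact (hf _).trans (pow_le_pow_of_le_one hr0 hr1.le (by nlinarith))
  obtain ⟨τ, hτ⟩ := cauchySeq_tendsto_of_complete
    (cauchySeq_of_le_geometric r (r ^ ((0 + 1) * (0 + 2))) hr1 (fun m => step 0 m))
  refine ⟨τ, hτ, fun n => ?_⟩
  have h := dist_le_of_le_geometric_of_tendsto₀ (f := fun m => f (m + n)) r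
    (r ^ ((n + 1) * (n + 2))) hr1 (step n) ((tendsto_add_atTop_iff_nat n).2 hτ)
  rw [dist_comm, Real.dist_eq, zero_add] at h
  refine h.trans ?_
  rw [div_le_iff₀ (by linarith)]
  have : 0 ≤ r ^ ((n + 1) * (n + 2)) := by positivity
  nlinarith

/-- the continued fraction `M(q) = K_{n=1}^∞ q^{2n}/(1 + q^n)`
with `q = a/b`, `a² < b` converges to an irrational number with
`μ_I ≤ 2 + 2 log a / (log b - 2 log a)`. -/
theorem mq_gcf_muI_le
    (a b : ℕ) (ha : 1 ≤ a) (hb : 1 ≤ b) (hab : a ^ 2 < b) :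
    ∃ τ : ℝ,
      Tendsto (fun n =>
          ((cfAQ (fun n => ((a : ℚ) / (b : ℚ)) ^ (2 * n))
              (fun n => 1 + ((a : ℚ) / (b : ℚ)) ^ n) n : ℝ) /
           (cfBQ (fun n => ((a : ℚ) / (b : ℚ)) ^ (2 * n))
              (fun n => 1 + ((a : ℚ) / (b : ℚ)) ^ n) n : ℝ)))
        atTop (nhds τ) ∧
      Irrational τ ∧
      muI τ ≤ ((2 + 2 * Real.log (a : ℝ) / (Real.log (b : ℝ) - 2 * Real.log (a : ℝ)) : ℝ) : EReal) := by
  have hbpos : (0 : ℚ) < b := by exact_mod_cast hb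
  have hapos : (0 : ℚ) < a := by exact_mod_cast ha
  set q : ℚ := (a : ℚ) / b with hq
  have hq0 : 0 < q := div_pos hapos hbpos
  have hq2 : q ≤ 1 / 2 := by
    rw [hq, div_le_div_iff₀ hbpos two_pos]
    have h1 : (a : ℚ) ^ 2 + 1 ≤ b := by exact_mod_cast hab
    nlinarith [sq_nonneg ((a : ℚ) - 1)]
  have hq1 : q ≤ 1 := by linarith
  set α : ℕ → ℚ := fun n => q ^ (2 * n) with hα
  set β : ℕ → ℚ := fun n => 1 + q ^ n with hβ
  have hB := cfBQ_bounds (α := α) (β := β) (fun n => by positivity)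
    (fun n => pow_le_one₀ hq0.le hq1)
    (fun n _ => by have : 0 < q ^ n := by positivity
                   simp only [hβ]; linarith)
    (fun n _ => by have : q ^ n ≤ 1 := pow_le_one₀ hq0.le hq1
                   simp only [hβ]; linarith)
  have hB1 : ∀ n, 1 ≤ cfBQ α β n := fun n => (hB n).1
  have hB3 : ∀ n, cfBQ α β n ≤ 3 ^ n := by
    intro n
    induction n with
    | zero => simp [cfBQ]
    | succ n ih => rw [pow_succ]; linarith [(hB n).2.2]
  have hdet : ∀ n, cfAQ α β (n + 1) * cfBQ α β n - cfAQ α β n * cfBQ α β (n + 1)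
      = (-1) ^ n * q ^ ((n + 1) * (n + 2)) := fun n => by
    rw [cf_determinant, ← prod_range_pow_two_mul]
  have hstep : ∀ n, |(cfAQ α β (n + 1) : ℝ) / cfBQ α β (n + 1) - (cfAQ α β n : ℝ) / cfBQ α β n|
      ≤ (q : ℝ) ^ ((n + 1) * (n + 2)) := by
    intro n
    have h1 := hB1 n
    have h2 := hB1 (n + 1)
    have h3 : |cfAQ α β (n + 1) / cfBQ α β (n + 1) - cfAQ α β n / cfBQ α β n|
        ≤ q ^ ((n + 1) * (n + 2)) := by
      rw [div_sub_div _ _ (by linarith) (by linarith), mul_comm (cfBQ α β (n + 1)) (cfAQ α β n),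
        hdet, abs_div, abs_mul, abs_pow, abs_neg, abs_one, one_pow, one_mul,
        abs_of_pos (pow_pos hq0 _), abs_of_pos (by nlinarith)]
      exact div_le_self (by positivity) (by nlinarith)
    exact_mod_cast h3
  have hq2R : (q : ℝ) ≤ 1 / 2 := by
    have h : ((q : ℚ) : ℝ) ≤ ((1 / 2 : ℚ) : ℝ) := Rat.cast_le.2 hq2
    simpa using h
  obtain ⟨τ, hτ, hτn⟩ := exists_tendsto_of_abs_step_le (r := (q : ℝ))
    (f := fun n => (cfAQ α β n : ℝ) / cfBQ α β n)
    (by exact_mod_cast hq0.le) hq2R hstep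
  obtain ⟨s, hs0, hs⟩ : ∃ s : ℕ → ℕ, s 0 = 0 ∧ ∀ n, s (n + 1) = s n + (n + 2) :=
    ⟨fun n => ∑ k ∈ Finset.range n, (k + 2), by simp, fun n => Finset.sum_range_succ _ _⟩
  have hs2 : ∀ n, (s n : ℝ) = n * (n + 3) / 2 := by
    intro n
    induction n with
    | zero => simp [hs0]
    | succ n ih => rw [hs]; push_cast; rw [ih]; ring
  choose P hP using exists_int_eq_mul_pow (a := a) (b := b) (by omega)
    (x := cfAQ α β) ⟨0, by simp [cfAQ]⟩
    ⟨a ^ 2, by simp only [cfAQ, hα, hq]; push_cast; field_simp⟩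
    (fun n => by simp [cfAQ, hα, hβ, hq]) hs0 hs
  choose Q hQ using exists_int_eq_mul_pow (a := a) (b := b) (by omega)
    (x := cfBQ α β) ⟨1, by simp [cfBQ]⟩
    ⟨b ^ 2 + a * b, by simp only [cfBQ, hβ, hq]; push_cast; field_simp⟩
    (fun n => by simp [cfBQ, hα, hβ, hq]) hs0 hs
  have hbs : ∀ n, (0 : ℚ) < (b : ℚ) ^ s n := fun n => by positivity
  have hQpos : ∀ n, 0 < Q n := fun n => by
    have : (0 : ℚ) < Q n := by
      rw [← hQ]
      exact mul_pos (by linarith [hB1 n]) (hbs n)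
    exact_mod_cast this
  have hne : ∀ n, P (n + 1) * Q n ≠ P n * Q (n + 1) := fun n h => by
    have h1 : (P (n + 1) : ℚ) * Q n = P n * Q (n + 1) := by exact_mod_cast h
    rw [← hP, ← hP, ← hQ, ← hQ] at h1
    have h2 : (cfAQ α β (n + 1) * cfBQ α β n - cfAQ α β n * cfBQ α β (n + 1))
        * ((b : ℚ) ^ s n * (b : ℚ) ^ s (n + 1)) = 0 := by linear_combination h1
    rw [hdet] at h2
    have h3 : (-1 : ℚ) ^ n * q ^ ((n + 1) * (n + 2)) ≠ 0 :=
      mul_ne_zero (pow_ne_zero _ (by norm_num)) (by positivity)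
    exact mul_ne_zero h3 (mul_pos (hbs n) (hbs _)).ne' h2
  have hbR : (0 : ℝ) < b := by exact_mod_cast hb
  have haR : (0 : ℝ) < a := by exact_mod_cast ha
  set L := Real.log b with hL
  set l := Real.log a with hl
  have hl0 : 0 ≤ l := Real.log_nonneg (by exact_mod_cast ha)
  have hLl : 2 * l < L := by
    have h1 : Real.log ((a : ℝ) ^ 2) < Real.log b :=
      Real.log_lt_log (by positivity) (by exact_mod_cast hab)
    rw [Real.log_pow] at h1
    exact_mod_cast h1
  have hbexp : ∀ k : ℕ, (b : ℝ) ^ k = Real.exp (k * L) := fun k => by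
    rw [Real.exp_nat_mul, hL, Real.exp_log hbR]
  have hqexp : ∀ k : ℕ, (q : ℝ) ^ k = Real.exp (k * (l - L)) := fun k => by
    rw [Real.exp_nat_mul, hL, hl, Real.exp_sub, Real.exp_log hbR, Real.exp_log haR, hq]
    push_cast; rfl
  set u : ℕ → ℝ := fun n => n * Real.log 3 + n * (n + 3) / 2 * L with hu
  have hQu : ∀ n, (Q n : ℝ) ≤ Real.exp (u n) := by
    intro n
    have h1 : (Q n : ℚ) ≤ 3 ^ n * (b : ℚ) ^ s n := by
      rw [← hQ]
      exact mul_le_mul_of_nonneg_right (hB3 n) (hbs n).le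
    have h2 : (Q n : ℝ) ≤ 3 ^ n * (b : ℝ) ^ s n := by exact_mod_cast h1
    have h3 : (3 : ℝ) ^ n = Real.exp (n * Real.log 3) := by
      rw [Real.exp_nat_mul, Real.exp_log (by norm_num)]
    rwa [h3, hbexp, hs2, ← Real.exp_add] at h2
  set e : ℕ → ℝ := fun n => -(Real.log 4 + u n + (n + 1) * (n + 2) * (l - L)) with he
  have happ : ∀ n, |(Q n : ℝ) * τ - P n| ≤ Real.exp (-e n) / 2 := by
    intro n
    have hQR : (0 : ℝ) < Q n := by exact_mod_cast hQpos n
    have hBR : (0 : ℝ) < cfBQ α β n := by exact_mod_cast lt_of_lt_of_le one_pos (hB1 n)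
    have h1 : (Q n : ℝ) * τ - P n = Q n * (τ - (cfAQ α β n : ℝ) / cfBQ α β n) := by
      have h2 : (cfAQ α β n : ℝ) * (b : ℝ) ^ s n = P n := by exact_mod_cast hP n
      have h3 : (cfBQ α β n : ℝ) * (b : ℝ) ^ s n = Q n := by exact_mod_cast hQ n
      rw [← h2, ← h3]; field_simp
    rw [h1, abs_mul, abs_of_pos hQR]
    have h4 : Real.exp (-e n) / 2 = Real.exp (u n) * (2 * (q : ℝ) ^ ((n + 1) * (n + 2))) := by
      rw [hqexp, he, neg_neg, Real.exp_add, Real.exp_add, Real.exp_log (by norm_num)]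
      push_cast; ring
    rw [h4]
    exact mul_le_mul (hQu n) (hτn n) (abs_nonneg _) (Real.exp_pos _).le
  have hetop : Tendsto e atTop atTop := by
    refine (tendsto_quadratic_atTop (A := L / 2 - l) (by linarith)
      (-(Real.log 3 + 3 / 2 * L + 3 * (l - L))) (-(Real.log 4 + 2 * (l - L)))).congr fun n => ?_
    simp only [he, hu]; ring
  have hmain : ∀ μ > 2 + 2 * l / (L - 2 * l), ∃ c > (0:ℝ), ∃ N₀ > (0:ℝ), ∀ M N : ℤ,
      (N : ℝ) ≥ N₀ → |τ - (M : ℝ) / (N : ℝ)| ≥ c / (N : ℝ) ^ μ := by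
    intro μ hμ
    have hμ1 : 1 ≤ μ := by
      have : 0 ≤ 2 * l / (L - 2 * l) := div_nonneg (by linarith) (by linarith)
      linarith
    have hA : 0 < (μ - 1) * (L / 2 - l) - L / 2 := by
      have h1 : 2 * l / (L - 2 * l) < μ - 2 := by linarith
      rw [div_lt_iff₀ (by linarith)] at h1
      linarith
    have hev : ∀ i : ℕ, ∀ᶠ n in atTop, u (n + i) ≤ (μ - 1) * e n := by
      intro i
      filter_upwards [(tendsto_quadratic_atTop hA
        ((μ - 1) * -(Real.log 3 + 3 / 2 * L + 3 * (l - L)) - (Real.log 3 + (2 * i + 3) / 2 * L))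
        ((μ - 1) * -(Real.log 4 + 2 * (l - L)) - (i * Real.log 3 + i * (i + 3) / 2 * L))
        ).eventually_ge_atTop 0] with n hn
      simp only [he, hu]
      push_cast
      linarith
    exact exists_lower_bound_of_approximations hμ1 P Q e u hQpos hQu happ hne hetop (hev 1) (hev 2)
  exact ⟨τ, hτ, irrational_of_lower_bound (hmain _ (lt_add_one _)), muI_le_of_forall_gt_s15 hmain⟩
end

section
/- Let u and v be positive rational numbers and let a = x/y and b = s/t with x, y, s, t positive integers satisfying y·t < min{x, s}. Then the Tasoev continued fraction T₂(u,v,a,b) = 1/(ua) + 1/(vb) + 1/(ua²) + 1/(vb²) + 1/(ua³) + ⋯ (a continued fraction with all partial numerators equal to 1 and partial denominators b_{2k-1} = u·a^k, b_{2k} = v·b^k for k ≥ 1) converges to an irrational number, and μ_I(T₂(u,v,a,b)) ≤ 2 + (log y + log t)/(log min{x,s} − log y − log t). -/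
open Filter

open Finset in
/-- The `m`-th triangular number `0 + 1 + ⋯ + m`. -/
def triangular (m : ℕ) : ℕ := ∑ k ∈ range (m + 1), k

lemma triangular_zero : triangular 0 = 0 := rfl

lemma triangular_succ (m : ℕ) : triangular (m + 1) = triangular m + (m + 1) :=
  Finset.sum_range_succ _ _

lemma tendsto_pow_mul_pow_triangular {G r : ℝ} (hG : 0 < G) (hr : 0 < r) (hr1 : r < 1) :
    Tendsto (fun m => G ^ m * r ^ triangular m) atTop (nhds 0) := by
  refine Summable.tendsto_atTop_zero (summable_of_ratio_test_tendsto_lt_one zero_lt_one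
    (Eventually.of_forall fun m => by positivity) ?_)
  have h : Tendsto (fun m : ℕ => G * r * r ^ m) atTop (nhds (G * r * 0)) :=
    (tendsto_pow_atTop_nhds_zero_of_lt_one hr.le hr1).const_mul _
  rw [mul_zero] at h
  refine h.congr fun m => ?_
  rw [Real.norm_of_nonneg (by positivity), Real.norm_of_nonneg (by positivity), triangular_succ]
  field_simp
  ring

/-- The set whose infimum defines `muI` contains `μ` as soon as `τ` has pairs of linearly
independent integer approximations whose quality is controlled by `μ`. -/
lemma exists_le_abs_sub_of_approx {τ μ C : ℝ} {Q ε : ℕ → ℝ} (hμ : 1 < μ) (hC : 0 < C)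
    (hε : ∀ m, 0 < ε m) (hQ : ∀ m, 0 < Q m) (hε0 : Tendsto ε atTop (nhds 0))
    (happrox : ∀ m, ∃ p q p' q' : ℤ, p * q' ≠ p' * q ∧ |(q : ℝ)| ≤ Q m ∧ |(q' : ℝ)| ≤ Q m ∧
      |(q : ℝ) * τ - p| ≤ ε m ∧ |(q' : ℝ) * τ - p'| ≤ ε m)
    (hQε : ∀ m, Q (m + 1) * ε m ^ (μ - 1) ≤ C) :
    ∃ c > (0 : ℝ), ∃ N₀ > (0 : ℝ), ∀ M N : ℤ,
      (N : ℝ) ≥ N₀ → |τ - (M : ℝ) / (N : ℝ)| ≥ c / (N : ℝ) ^ μ := by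
  refine ⟨1 / (2 * C * 2 ^ (μ - 1)), by positivity, 1 / (2 * ε 0),
    by have := hε 0; positivity, ?_⟩
  intro M N hN
  have hN0 : (0 : ℝ) < N := lt_of_lt_of_le (by have := hε 0; positivity) hN
  have hex : ∃ m, 2 * N * ε m < 1 := by
    have h := (hε0.const_mul (2 * (N : ℝ))).eventually_lt_const
      (show 2 * (N : ℝ) * 0 < 1 by simp)
    exact h.exists
  classical
  obtain ⟨m, hm, hmin⟩ : ∃ m, 2 * N * ε m < 1 ∧ ∀ k < m, ¬ 2 * N * ε k < 1 :=
    ⟨Nat.find hex, Nat.find_spec hex, fun k hk => Nat.find_min hex hk⟩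
  have h0 : 1 ≤ 2 * N * ε 0 := by
    have := hε 0
    rw [ge_iff_le, div_le_iff₀ (by positivity)] at hN
    linarith
  obtain _ | k := m
  · linarith
  have hk : 1 ≤ 2 * N * ε k := not_lt.mp (hmin k (Nat.lt_succ_self k))
  have key : ∀ p q : ℤ, p * N - q * M ≠ 0 → |(q : ℝ)| ≤ Q (k + 1) →
      |(q : ℝ) * τ - p| ≤ ε (k + 1) → 1 / 2 ≤ Q (k + 1) * |N * τ - M| := by
    intro p q hne hq hp
    have h1 : (1 : ℝ) ≤ |(p : ℝ) * N - q * M| := by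
      exact_mod_cast Int.one_le_abs hne
    have h2 : (p : ℝ) * N - q * M = -(N * (q * τ - p)) + q * (N * τ - M) := by ring
    have h3 : |(p : ℝ) * N - q * M| ≤ N * ε (k + 1) + Q (k + 1) * |N * τ - M| := by
      rw [h2]
      refine (abs_add_le _ _).trans ?_
      rw [abs_neg, abs_mul, abs_mul, abs_of_pos hN0]
      gcongr
    linarith
  have hmain : 1 / 2 ≤ Q (k + 1) * |N * τ - M| := by
    obtain ⟨p, q, p', q', hdet, hq, hq', hp, hp'⟩ := happrox (k + 1)
    by_cases h : p * N - q * M = 0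
    · by_cases h' : p' * N - q' * M = 0
      · exfalso
        have hNZ : N ≠ 0 := by
          rintro rfl
          simp at hN0
        apply hdet
        apply mul_right_cancel₀ hNZ
        linear_combination q' * h - q * h'
      · exact key p' q' h' hq' hp'
    · exact key p q h hq hp
  have habs : |(N : ℝ) * τ - M| = N * |τ - M / N| := by
    rw [← abs_of_pos hN0, ← abs_mul, abs_of_pos hN0]
    congr 1
    field_simp
  have hpow : (1 : ℝ) ≤ 2 ^ (μ - 1) * (N : ℝ) ^ (μ - 1) * ε k ^ (μ - 1) := by
    rw [← Real.mul_rpow (by positivity) hN0.le, ← Real.mul_rpow (by positivity) (hε k).le]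
    exact Real.one_le_rpow hk (by linarith)
  have hQle : Q (k + 1) ≤ C * (2 ^ (μ - 1) * (N : ℝ) ^ (μ - 1)) := by
    have h1 := hQε k
    have h2 : Q (k + 1) * 1 ≤ Q (k + 1) * (2 ^ (μ - 1) * (N : ℝ) ^ (μ - 1) * ε k ^ (μ - 1)) :=
      mul_le_mul_of_nonneg_left hpow (hQ _).le
    have h3 : Q (k + 1) * ε k ^ (μ - 1) * (2 ^ (μ - 1) * (N : ℝ) ^ (μ - 1))
        ≤ C * (2 ^ (μ - 1) * (N : ℝ) ^ (μ - 1)) :=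
      mul_le_mul_of_nonneg_right h1 (by positivity)
    linarith
  have hNμ : (N : ℝ) ^ μ = N ^ (μ - 1) * N := by
    rw [Real.rpow_sub_one hN0.ne']
    field_simp
  rw [ge_iff_le, div_div, div_le_iff₀ (by positivity), hNμ]
  have h4 : Q (k + 1) * |N * τ - M|
      ≤ C * (2 ^ (μ - 1) * (N : ℝ) ^ (μ - 1)) * |N * τ - M| :=
    mul_le_mul_of_nonneg_right hQle (abs_nonneg _)
  rw [habs] at h4 hmain
  linarith

/-- A real number with a finite irrationality measure (asymptotically, and with
non-reduced fractions allowed) is irrational. -/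
lemma irrational_of_exists_le_abs_sub {τ μ : ℝ}
    (h : ∃ c > (0 : ℝ), ∃ N₀ > (0 : ℝ), ∀ M N : ℤ,
      (N : ℝ) ≥ N₀ → |τ - (M : ℝ) / (N : ℝ)| ≥ c / (N : ℝ) ^ μ) : Irrational τ := by
  obtain ⟨c, hc, N₀, hN₀, h⟩ := h
  rintro ⟨r, rfl⟩
  obtain ⟨k, hk⟩ := exists_nat_gt N₀
  have hk0 : (0 : ℝ) < k := hN₀.trans hk
  have hd : (1 : ℝ) ≤ r.den := by exact_mod_cast r.den_pos
  have hN : N₀ ≤ (k : ℝ) * r.den := by nlinarith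
  have h1 := h (k * r.num) (k * r.den) (by push_cast; exact hN)
  push_cast at h1
  have h2 : (r : ℝ) - (k * r.num) / (k * r.den) = 0 := by
    rw [mul_div_mul_left _ _ hk0.ne', ← Rat.cast_def, sub_self]
  rw [h2, abs_zero] at h1
  have : (0 : ℝ) < c / ((k : ℝ) * r.den) ^ μ := by positivity
  linarith

/-- Approximations with denominators of size `G₁ᵐ X^(m²/2)` and errors of size `G₂ᵐ ρ^(m²/2)`. -/
lemma exists_le_abs_sub_of_triangular {τ μ X ρ C₁ C₂ G₁ G₂ : ℝ} (hμ : 1 < μ)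
    (hX : 0 < X) (hρ : 0 < ρ) (hρ1 : ρ < 1) (hC₁ : 0 < C₁) (hC₂ : 0 < C₂)
    (hG₁ : 0 < G₁) (hG₂ : 0 < G₂) (hXρ : X * ρ ^ (μ - 1) < 1)
    (happrox : ∀ m, ∃ p q p' q' : ℤ, p * q' ≠ p' * q ∧
      |(q : ℝ)| ≤ C₁ * (G₁ ^ m * X ^ triangular m) ∧
      |(q' : ℝ)| ≤ C₁ * (G₁ ^ m * X ^ triangular m) ∧
      |(q : ℝ) * τ - p| ≤ C₂ * (G₂ ^ m * ρ ^ triangular m) ∧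
      |(q' : ℝ) * τ - p'| ≤ C₂ * (G₂ ^ m * ρ ^ triangular m)) :
    ∃ c > (0 : ℝ), ∃ N₀ > (0 : ℝ), ∀ M N : ℤ,
      (N : ℝ) ≥ N₀ → |τ - (M : ℝ) / (N : ℝ)| ≥ c / (N : ℝ) ^ μ := by
  obtain ⟨K, hK⟩ := (tendsto_pow_mul_pow_triangular (G := G₁ * X * G₂ ^ (μ - 1))
    (by positivity) (by positivity) hXρ).bddAbove_range
  have hK0 : 0 ≤ K := (by positivity : (0 : ℝ) ≤ _).trans (hK ⟨0, rfl⟩)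
  refine exists_le_abs_sub_of_approx (C := C₁ * G₁ * X * C₂ ^ (μ - 1) * (K + 1)) hμ
    (by positivity) (fun m => by positivity) (fun m => by positivity) ?_ happrox ?_
  · simpa using (tendsto_pow_mul_pow_triangular hG₂ hρ hρ1).const_mul C₂
  · intro m
    have hKm : (G₁ * X * G₂ ^ (μ - 1)) ^ m * (X * ρ ^ (μ - 1)) ^ triangular m ≤ K := hK ⟨m, rfl⟩
    have e1 : (C₂ * (G₂ ^ m * ρ ^ triangular m)) ^ (μ - 1)
        = C₂ ^ (μ - 1) * ((G₂ ^ (μ - 1)) ^ m * (ρ ^ (μ - 1)) ^ triangular m) := by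
      rw [Real.mul_rpow hC₂.le (by positivity), Real.mul_rpow (by positivity) (by positivity),
        Real.rpow_pow_comm hG₂.le, Real.rpow_pow_comm hρ.le]
    calc _ = C₁ * G₁ * X * C₂ ^ (μ - 1)
          * ((G₁ * X * G₂ ^ (μ - 1)) ^ m * (X * ρ ^ (μ - 1)) ^ triangular m) := by
          rw [e1, triangular_succ]
          ring
      _ ≤ _ := by
          gcongr
          linarith

section ContinuedFraction

variable {b : ℕ → ℚ} {β : ℚ}

local notation "A" => cfAQ (fun _ => 1) b
local notation "B" => cfBQ (fun _ => 1) b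

lemma cfAQ_one_succ (n : ℕ) : A (n + 2) = b (n + 2) * A (n + 1) + A n := by
  rw [cfAQ, one_mul]

lemma cfBQ_one_succ (n : ℕ) : B (n + 2) = b (n + 2) * B (n + 1) + B n := by
  rw [cfBQ, one_mul]

lemma cf_det (n : ℕ) : B n * A (n + 1) - A n * B (n + 1) = (-1) ^ n := by
  induction n with
  | zero => simp [cfAQ, cfBQ]
  | succ n ih =>
    rw [cfAQ_one_succ, cfBQ_one_succ, pow_succ, ← ih]
    ring

lemma cfBQ_pos (hb : ∀ n, 0 < b (n + 1)) (n : ℕ) : 0 < B n := by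
  induction n using Nat.twoStepInduction with
  | zero => simp [cfBQ]
  | one => exact hb 0
  | more n h0 h1 =>
    rw [cfBQ_one_succ]
    have := hb (n + 1)
    positivity

lemma abs_cross_mul_le (hb : ∀ n, 0 < b (n + 1)) (n k : ℕ) :
    |B n * A (n + k) - A n * B (n + k)| * B (n + 1) ≤ B (n + k) := by
  induction k using Nat.twoStepInduction with
  | zero =>
    rw [add_zero, mul_comm (B n), sub_self]
    simpa using (cfBQ_pos hb n).le
  | one => simp [cf_det]
  | more k h0 h1 =>
    have hbk := hb (n + k + 1)
    have hB := cfBQ_pos hb (n + 1)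
    rw [← add_assoc] at h1
    rw [← add_assoc, cfAQ_one_succ, cfBQ_one_succ]
    have e : B n * (b (n + k + 2) * A (n + k + 1) + A (n + k))
        - A n * (b (n + k + 2) * B (n + k + 1) + B (n + k))
        = b (n + k + 2) * (B n * A (n + k + 1) - A n * B (n + k + 1))
          + (B n * A (n + k) - A n * B (n + k)) := by ring
    calc _ ≤ (b (n + k + 2) * |B n * A (n + k + 1) - A n * B (n + k + 1)|
          + |B n * A (n + k) - A n * B (n + k)|) * B (n + 1) := by
          rw [e]
          gcongr
          refine (abs_add_le _ _).trans_eq ?_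
          rw [abs_mul, abs_of_pos hbk]
      _ = b (n + k + 2) * (|B n * A (n + k + 1) - A n * B (n + k + 1)| * B (n + 1))
          + |B n * A (n + k) - A n * B (n + k)| * B (n + 1) := by ring
      _ ≤ _ := by gcongr

lemma abs_convergent_sub_le (hb : ∀ n, 0 < b (n + 1)) {n m : ℕ} (h : n ≤ m) :
    |A n / B n - A m / B m| ≤ 1 / (B n * B (n + 1)) := by
  obtain ⟨k, rfl⟩ := Nat.exists_eq_add_of_le h
  have h0 := cfBQ_pos hb n
  have h1 := cfBQ_pos hb (n + 1)
  have h2 := cfBQ_pos hb (n + k)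
  rw [abs_sub_comm, div_sub_div _ _ h2.ne' h0.ne', abs_div, abs_of_pos (mul_pos h2 h0),
    div_le_div_iff₀ (by positivity) (by positivity)]
  have := mul_le_mul_of_nonneg_right (abs_cross_mul_le hb n k) h0.le
  rw [mul_comm (A (n + k)), mul_comm (B (n + k)) (A n)]
  linarith

lemma le_cfBQ (hβ : 0 < β) (hβ1 : β ≤ 1) (hb : ∀ n, β ≤ b (n + 1)) (n : ℕ) : β ≤ B n := by
  have hb' : ∀ n, 0 < b (n + 1) := fun n => hβ.trans_le (hb n)
  induction n using Nat.twoStepInduction with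
  | zero => simpa [cfBQ] using hβ1
  | one => exact hb 0
  | more n h0 h1 =>
    rw [cfBQ_one_succ]
    have := mul_pos (hb' (n + 1)) (cfBQ_pos hb' (n + 1))
    linarith

lemma le_cfBQ_mul_cfBQ (hβ : 0 < β) (hβ1 : β ≤ 1) (hb : ∀ n, β ≤ b (n + 1)) (n : ℕ) :
    β ^ 3 * (n + 1) ≤ B n * B (n + 1) := by
  induction n with
  | zero =>
    have h := le_cfBQ hβ hβ1 hb 1
    have : β ^ 3 ≤ β := pow_le_of_le_one hβ.le hβ1 (by norm_num)
    simpa [cfBQ] using this.trans h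
  | succ n ih =>
    have h := le_cfBQ hβ hβ1 hb (n + 1)
    have h' : β * (β * β) ≤ b (n + 2) * (B (n + 1) * B (n + 1)) := by
      have hbn := hb (n + 1)
      have hb0 := hβ.le.trans hbn
      have hB0 := hβ.le.trans h
      gcongr
    rw [cfBQ_one_succ]
    push_cast
    linarith

/-- A continued fraction with unit numerators and partial denominators bounded away from `0`
converges, with the usual bound on the quality of its convergents. -/
lemma exists_tendsto_convergents (hβ : 0 < β) (hβ1 : β ≤ 1) (hb : ∀ n, β ≤ b (n + 1)) :
    ∃ τ : ℝ, Tendsto (fun n => ((A n : ℚ) : ℝ) / ((B n : ℚ) : ℝ)) atTop (nhds τ) ∧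
      ∀ n, |((B n : ℚ) : ℝ) * τ - ((A n : ℚ) : ℝ)| ≤ 1 / ((B (n + 1) : ℚ) : ℝ) := by
  have hb' : ∀ n, 0 < b (n + 1) := fun n => hβ.trans_le (hb n)
  have hdist : ∀ n m, n ≤ m →
      |((A n : ℚ) : ℝ) / ((B n : ℚ) : ℝ) - ((A m : ℚ) : ℝ) / ((B m : ℚ) : ℝ)|
      ≤ 1 / (((B n : ℚ) : ℝ) * ((B (n + 1) : ℚ) : ℝ)) := by
    intro n m h
    exact_mod_cast abs_convergent_sub_le hb' h
  have hlim : Tendsto (fun n => 1 / (((B n : ℚ) : ℝ) * ((B (n + 1) : ℚ) : ℝ))) atTop (nhds 0) := by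
    have h1 : Tendsto (fun n : ℕ => 1 / (β : ℝ) ^ 3 * (1 / ((n : ℝ) + 1))) atTop (nhds 0) := by
      simpa only [mul_zero] using
        (tendsto_one_div_add_atTop_nhds_zero_nat (𝕜 := ℝ)).const_mul (1 / (β : ℝ) ^ 3)
    have hβR : (0 : ℝ) < β := by exact_mod_cast hβ
    refine squeeze_zero (fun n => ?_) (fun n => ?_) h1
    · have h0 : (0 : ℝ) < (B n : ℚ) := by exact_mod_cast cfBQ_pos hb' n
      have h1 : (0 : ℝ) < (B (n + 1) : ℚ) := by exact_mod_cast cfBQ_pos hb' (n + 1)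
      positivity
    · rw [← one_div_mul_one_div_rev, mul_comm, one_div_mul_one_div_rev, one_div_mul_one_div_rev]
      refine one_div_le_one_div_of_le (by positivity) ?_
      have := le_cfBQ_mul_cfBQ hβ hβ1 hb n
      rw [mul_comm (((n : ℝ) + 1))]
      rw [mul_comm ((B (n + 1) : ℚ) : ℝ)]
      exact_mod_cast this
  obtain ⟨τ, hτ⟩ := cauchySeq_tendsto_of_complete
    (cauchySeq_of_le_tendsto_0' _ (fun n m h => by rw [Real.dist_eq]; exact hdist n m h) hlim)
  refine ⟨τ, hτ, fun n => ?_⟩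
  have h0 : (0 : ℝ) < (B n : ℚ) := by exact_mod_cast cfBQ_pos hb' n
  have h1 : (0 : ℝ) < (B (n + 1) : ℚ) := by exact_mod_cast cfBQ_pos hb' (n + 1)
  have hle := le_of_tendsto (hτ.const_sub (((A n : ℚ) : ℝ) / ((B n : ℚ) : ℝ))).abs
    ((eventually_ge_atTop n).mono fun m hm => hdist n m hm)
  have e : ((B n : ℚ) : ℝ) * τ - ((A n : ℚ) : ℝ)
      = -(((B n : ℚ) : ℝ) * (((A n : ℚ) : ℝ) / ((B n : ℚ) : ℝ) - τ)) := by
    field_simp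
    ring
  rw [e, abs_neg, abs_mul, abs_of_pos h0]
  refine (mul_le_mul_of_nonneg_left hle h0.le).trans_eq ?_
  field_simp

open Finset

lemma prod_le_cfBQ (hb : ∀ n, 0 < b (n + 1)) (n : ℕ) : ∏ i ∈ range n, b (i + 1) ≤ B n := by
  induction n using Nat.twoStepInduction with
  | zero => simp [cfBQ]
  | one => simp [cfBQ]
  | more n h0 h1 =>
    rw [cfBQ_one_succ, prod_range_succ, mul_comm]
    have := mul_le_mul_of_nonneg_left h1 (hb (n + 1)).le
    have := cfBQ_pos hb n
    linarith

lemma cfBQ_le_prod (hb : ∀ n, 0 < b (n + 1)) (n : ℕ) : B n ≤ ∏ i ∈ range n, (1 + b (i + 1)) := by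
  induction n using Nat.twoStepInduction with
  | zero => simp [cfBQ]
  | one => simp [cfBQ]
  | more n h0 h1 =>
    have hbn := hb n
    have hbn1 := hb (n + 1)
    have hp : 0 < ∏ i ∈ range n, (1 + b (i + 1)) :=
      prod_pos fun i _ => by have := hb i; positivity
    rw [cfBQ_one_succ, prod_range_succ]
    have h2 := mul_le_mul_of_nonneg_left h1 hbn1.le
    rw [prod_range_succ] at h2 ⊢
    have h3 : 0 < (∏ i ∈ range n, (1 + b (i + 1))) * b (n + 1) := by positivity
    linarith

lemma exists_int_eq_prod_mul {d : ℕ → ℕ} (hd : ∀ n, ∃ z : ℤ, (d n : ℚ) * b n = z)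
    (n : ℕ) :
    (∃ z : ℤ, ((∏ i ∈ range n, d (i + 1) : ℕ) : ℚ) * A n = z) ∧
      ∃ z : ℤ, ((∏ i ∈ range n, d (i + 1) : ℕ) : ℚ) * B n = z := by
  induction n using Nat.twoStepInduction with
  | zero => exact ⟨⟨0, by simp [cfAQ]⟩, ⟨1, by simp [cfBQ]⟩⟩
  | one =>
    obtain ⟨z, hz⟩ := hd 1
    exact ⟨⟨d 1, by simp [cfAQ]⟩, ⟨z, by simp [cfBQ, hz]⟩⟩
  | more n h0 h1 =>
    obtain ⟨z, hz⟩ := hd (n + 2)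
    obtain ⟨⟨p, hp⟩, ⟨q, hq⟩⟩ := h0
    obtain ⟨⟨p', hp'⟩, ⟨q', hq'⟩⟩ := h1
    rw [prod_range_succ] at hp' hq'
    refine ⟨⟨z * p' + d (n + 2) * d (n + 1) * p, ?_⟩, ⟨z * q' + d (n + 2) * d (n + 1) * q, ?_⟩⟩
    · rw [cfAQ_one_succ, prod_range_succ, prod_range_succ]
      push_cast at *
      rw [← hz, ← hp, ← hp']
      ring
    · rw [cfBQ_one_succ, prod_range_succ, prod_range_succ]
      push_cast at *
      rw [← hz, ← hq, ← hq']
      ring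

/-- Clearing denominators in two consecutive convergents. -/
lemma exists_int_approx {d : ℕ → ℕ} (hβ : 0 < β) (hβ1 : β ≤ 1) (hb : ∀ n, β ≤ b (n + 1))
    (hd : ∀ n, ∃ z : ℤ, (d n : ℚ) * b n = z) (hd1 : ∀ n, 1 ≤ d n) {τ : ℝ}
    (hτ : ∀ n, |((B n : ℚ) : ℝ) * τ - ((A n : ℚ) : ℝ)| ≤ 1 / ((B (n + 1) : ℚ) : ℝ)) (n : ℕ) :
    ∃ p q p' q' : ℤ, p * q' ≠ p' * q ∧
      |(q : ℝ)| ≤ (((∏ i ∈ range (n + 2), (d (i + 1) : ℚ)) *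
        ∏ i ∈ range (n + 2), (1 + b (i + 1)) : ℚ) : ℝ) ∧
      |(q' : ℝ)| ≤ (((∏ i ∈ range (n + 2), (d (i + 1) : ℚ)) *
        ∏ i ∈ range (n + 2), (1 + b (i + 1)) : ℚ) : ℝ) ∧
      |(q : ℝ) * τ - p| ≤ (((∏ i ∈ range (n + 2), (d (i + 1) : ℚ)) /
        (β ^ 2 * ∏ i ∈ range n, b (i + 1)) : ℚ) : ℝ) ∧
      |(q' : ℝ) * τ - p'| ≤ (((∏ i ∈ range (n + 2), (d (i + 1) : ℚ)) /
        (β ^ 2 * ∏ i ∈ range n, b (i + 1)) : ℚ) : ℝ) := by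
  have hb' : ∀ n, 0 < b (n + 1) := fun n => hβ.trans_le (hb n)
  have hdpos : ∀ n, (1 : ℚ) ≤ d n := fun n => by exact_mod_cast hd1 n
  have hL : 0 < ∏ i ∈ range n, b (i + 1) := prod_pos fun i _ => hb' i
  have hDpos : ∀ k, 0 < ∏ i ∈ range k, (d (i + 1) : ℚ) := fun k =>
    prod_pos fun i _ => zero_lt_one.trans_le (hdpos _)
  have hD : ∀ k, ∏ i ∈ range k, (d (i + 1) : ℚ) ≤ ∏ i ∈ range (k + 1), (d (i + 1) : ℚ) := by
    intro k
    rw [prod_range_succ]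
    exact le_mul_of_one_le_right (hDpos k).le (hdpos _)
  have hU : ∀ k, ∏ i ∈ range k, (1 + b (i + 1)) ≤ ∏ i ∈ range (k + 1), (1 + b (i + 1)) := by
    intro k
    rw [prod_range_succ]
    refine le_mul_of_one_le_right (prod_pos fun i _ => ?_).le ?_
    · have := hb' i
      positivity
    · have := hb' k
      linarith
  have hL1 : β ^ 2 * ∏ i ∈ range n, b (i + 1) ≤ B (n + 1) := by
    refine le_trans ?_ (prod_le_cfBQ hb' (n + 1))
    rw [prod_range_succ, mul_comm]
    gcongr
    exact (pow_le_of_le_one hβ.le hβ1 (by norm_num)).trans (hb n)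
  have hL2 : β ^ 2 * ∏ i ∈ range n, b (i + 1) ≤ B (n + 2) := by
    refine le_trans ?_ (prod_le_cfBQ hb' (n + 2))
    rw [prod_range_succ, prod_range_succ, mul_comm, mul_assoc, sq]
    have hbn := hb n
    have hbn1 := hb (n + 1)
    have hb0 := hb' n
    gcongr
  have hq : ∀ k (z : ℤ), ((∏ i ∈ range k, d (i + 1) : ℕ) : ℚ) * B k = z →
      ∏ i ∈ range k, (d (i + 1) : ℚ) ≤ ∏ i ∈ range (n + 2), (d (i + 1) : ℚ) →
      ∏ i ∈ range k, (1 + b (i + 1)) ≤ ∏ i ∈ range (n + 2), (1 + b (i + 1)) →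
      |(z : ℝ)| ≤ (((∏ i ∈ range (n + 2), (d (i + 1) : ℚ)) *
        ∏ i ∈ range (n + 2), (1 + b (i + 1)) : ℚ) : ℝ) := by
    intro k z hz h1 h2
    have hz0 : |(z : ℚ)| ≤ (∏ i ∈ range (n + 2), (d (i + 1) : ℚ)) *
        ∏ i ∈ range (n + 2), (1 + b (i + 1)) := by
      rw [← hz, Nat.cast_prod, abs_of_pos (mul_pos (hDpos k) (cfBQ_pos hb' k))]
      have := (cfBQ_le_prod hb' k).trans h2
      exact mul_le_mul h1 this (cfBQ_pos hb' k).le (hDpos _).le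
    exact_mod_cast hz0
  have hp : ∀ k (w z : ℤ), ((∏ i ∈ range k, d (i + 1) : ℕ) : ℚ) * A k = w →
      ((∏ i ∈ range k, d (i + 1) : ℕ) : ℚ) * B k = z →
      ∏ i ∈ range k, (d (i + 1) : ℚ) ≤ ∏ i ∈ range (n + 2), (d (i + 1) : ℚ) →
      β ^ 2 * ∏ i ∈ range n, b (i + 1) ≤ B (k + 1) →
      |(z : ℝ) * τ - w| ≤ (((∏ i ∈ range (n + 2), (d (i + 1) : ℚ)) /
        (β ^ 2 * ∏ i ∈ range n, b (i + 1)) : ℚ) : ℝ) := by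
    intro k w z hw hz h1 h2
    rw [Nat.cast_prod] at hw hz
    have hwR : ((∏ i ∈ range k, (d (i + 1) : ℚ) : ℚ) : ℝ) * ((A k : ℚ) : ℝ) = w := by
      exact_mod_cast congrArg (Rat.cast (K := ℝ)) hw
    have hzR : ((∏ i ∈ range k, (d (i + 1) : ℚ) : ℚ) : ℝ) * ((B k : ℚ) : ℝ) = z := by
      exact_mod_cast congrArg (Rat.cast (K := ℝ)) hz
    have hDR : (0 : ℝ) < ((∏ i ∈ range k, (d (i + 1) : ℚ) : ℚ) : ℝ) := by
      exact_mod_cast hDpos k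
    rw [← hwR, ← hzR, mul_assoc, ← mul_sub, abs_mul, abs_of_pos hDR]
    refine (mul_le_mul_of_nonneg_left (hτ k) hDR.le).trans ?_
    have : (∏ i ∈ range k, (d (i + 1) : ℚ)) * (1 / B (k + 1)) ≤
        (∏ i ∈ range (n + 2), (d (i + 1) : ℚ)) / (β ^ 2 * ∏ i ∈ range n, b (i + 1)) := by
      rw [mul_one_div]
      have := hDpos (n + 2)
      gcongr
    exact_mod_cast this
  obtain ⟨⟨p, hp0⟩, ⟨q, hq0⟩⟩ := exists_int_eq_prod_mul hd n
  obtain ⟨⟨p', hp1⟩, ⟨q', hq1⟩⟩ := exists_int_eq_prod_mul hd (n + 1)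
  refine ⟨p, q, p', q', ?_, hq n q hq0 ((hD n).trans (hD _)) ((hU n).trans (hU _)),
    hq _ q' hq1 (hD _) (hU _), hp n p q hp0 hq0 ((hD n).trans (hD _)) hL1,
    hp _ p' q' hp1 hq1 (hD _) hL2⟩
  intro h
  have hQ : (p : ℚ) * q' = p' * q := by exact_mod_cast h
  rw [← hp0, ← hq0, ← hp1, ← hq1, Nat.cast_prod, Nat.cast_prod] at hQ
  have hdet := cf_det (b := b) n
  have h1 := (hDpos n).ne'
  have h2 := (hDpos (n + 1)).ne'
  have : B n * A (n + 1) - A n * B (n + 1) = 0 := by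
    refine mul_left_cancel₀ (mul_ne_zero h1 h2) ?_
    linear_combination -hQ
  rw [this] at hdet
  exact pow_ne_zero n (by norm_num : (-1 : ℚ) ≠ 0) hdet.symm

end ContinuedFraction

/-- The sequence `wα, zγ, wα², zγ², …` (indexed from `1`) interleaving two geometric
progressions. -/
def interleave (w z α γ : ℚ) (n : ℕ) : ℚ :=
  if Odd n then w * α ^ ((n + 1) / 2) else z * γ ^ (n / 2)

lemma interleave_odd (w z α γ : ℚ) (k : ℕ) :
    interleave w z α γ (2 * k + 1) = w * α ^ (k + 1) := by
  rw [interleave, if_pos (odd_two_mul_add_one k), show (2 * k + 1 + 1) / 2 = k + 1 by omega]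

lemma interleave_even (w z α γ : ℚ) (k : ℕ) :
    interleave w z α γ (2 * k + 1 + 1) = z * γ ^ (k + 1) := by
  rw [interleave, if_neg (by simp [parity_simps]),
    show (2 * k + 1 + 1) / 2 = k + 1 by omega]

lemma le_interleave {β w z α γ : ℚ} (hβ : 0 ≤ β) (hw : β ≤ w) (hz : β ≤ z) (hα : 1 ≤ α)
    (hγ : 1 ≤ γ) (n : ℕ) : β ≤ interleave w z α γ n := by
  unfold interleave
  split_ifs
  · exact hw.trans (le_mul_of_one_le_right (hβ.trans hw) (one_le_pow₀ hα))
  · exact hz.trans (le_mul_of_one_le_right (hβ.trans hz) (one_le_pow₀ hγ))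

lemma one_add_interleave_le {w z α γ : ℚ} (hα : 1 ≤ α) (hγ : 1 ≤ γ) (n : ℕ) :
    1 + interleave w z α γ n ≤ interleave (1 + w) (1 + z) α γ n := by
  unfold interleave
  split_ifs
  · have := one_le_pow₀ hα (n := (n + 1) / 2)
    linarith
  · have := one_le_pow₀ hγ (n := n / 2)
    linarith

/-- The product of the first `2m` terms of two interleaved geometric progressions. -/
lemma prod_range_interleave (w z α γ : ℚ) (m : ℕ) :
    ∏ i ∈ Finset.range (2 * m), interleave w z α γ (i + 1) =
      (w * z) ^ m * (α * γ) ^ triangular m := by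
  induction m with
  | zero => simp [triangular_zero]
  | succ m ih =>
    rw [show 2 * (m + 1) = 2 * m + 1 + 1 by ring, Finset.prod_range_succ, Finset.prod_range_succ,
      ih, interleave_odd, interleave_even, triangular_succ]
    ring

/-- Clearing denominators in the partial denominators of `T₂(u,v,a,b)`. -/
lemma exists_int_eq_den_mul_interleave (u v : ℚ) {x y s t : ℕ} (hy : 1 ≤ y) (ht : 1 ≤ t) (n : ℕ) :
    ∃ z : ℤ, interleave u.den v.den y t n * interleave u v (x / y) (s / t) n = z := by
  have hy0 : (y : ℚ) ≠ 0 := by positivity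
  have ht0 : (t : ℚ) ≠ 0 := by positivity
  unfold interleave
  split_ifs
  · refine ⟨u.num * x ^ ((n + 1) / 2), ?_⟩
    push_cast
    rw [← Rat.mul_den_eq_num u, div_pow]
    field_simp
  · refine ⟨v.num * s ^ (n / 2), ?_⟩
    push_cast
    rw [← Rat.mul_den_eq_num v, div_pow]
    field_simp

/-- The integer approximations to `T₂(u,v,a,b)` given by its convergents. -/
lemma tasoev_exists_approx {u v : ℚ} (hu : 0 < u) (hv : 0 < v) {x y s t : ℕ}
    (hy : 1 ≤ y) (ht : 1 ≤ t) (hyx : y ≤ x) (hts : t ≤ s) :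
    ∃ τ : ℝ, Tendsto (fun n =>
        ((cfAQ (fun _ => 1) (interleave u v (x / y) (s / t)) n : ℚ) : ℝ) /
          ((cfBQ (fun _ => 1) (interleave u v (x / y) (s / t)) n : ℚ) : ℝ)) atTop (nhds τ) ∧
      ∃ C₁ > (0 : ℝ), ∃ C₂ > (0 : ℝ), ∃ G₁ > (0 : ℝ), ∃ G₂ > (0 : ℝ),
        ∀ m, ∃ p q p' q' : ℤ, p * q' ≠ p' * q ∧
          |(q : ℝ)| ≤ C₁ * (G₁ ^ m * (x * s : ℝ) ^ triangular m) ∧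
          |(q' : ℝ)| ≤ C₁ * (G₁ ^ m * (x * s : ℝ) ^ triangular m) ∧
          |(q : ℝ) * τ - p| ≤ C₂ * (G₂ ^ m * ((y * t) ^ 2 / (x * s) : ℝ) ^ triangular m) ∧
          |(q' : ℝ) * τ - p'| ≤ C₂ * (G₂ ^ m * ((y * t) ^ 2 / (x * s) : ℝ) ^ triangular m) := by
  have hx : 1 ≤ x := hy.trans hyx
  have hs : 1 ≤ s := ht.trans hts
  have hxR : (0 : ℝ) < x := by positivity
  have hyR : (0 : ℝ) < y := by positivity
  have hsR : (0 : ℝ) < s := by positivity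
  have htR : (0 : ℝ) < t := by positivity
  have hxQ : (0 : ℚ) < x := by positivity
  have hyQ : (0 : ℚ) < y := by positivity
  have hsQ : (0 : ℚ) < s := by positivity
  have htQ : (0 : ℚ) < t := by positivity
  have ha : (1 : ℚ) ≤ x / y := by
    rw [one_le_div hyQ]
    exact_mod_cast hyx
  have hb : (1 : ℚ) ≤ s / t := by
    rw [one_le_div htQ]
    exact_mod_cast hts
  obtain ⟨β, hβ, hβ1, hβu, hβv⟩ : ∃ β : ℚ, 0 < β ∧ β ≤ 1 ∧ β ≤ u ∧ β ≤ v :=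
    ⟨min 1 (min u v), by positivity, min_le_left _ _, (min_le_right _ _).trans (min_le_left _ _),
      (min_le_right _ _).trans (min_le_right _ _)⟩
  have hβb : ∀ n, β ≤ interleave u v (x / y) (s / t) (n + 1) := fun n =>
    le_interleave hβ.le hβu hβv ha hb _
  obtain ⟨τ, hτ, happ⟩ := exists_tendsto_convergents hβ hβ1 hβb
  refine ⟨τ, hτ, ?_⟩
  have hud : (0 : ℚ) < u.den := by exact_mod_cast u.den_pos
  have hvd : (0 : ℚ) < v.den := by exact_mod_cast v.den_pos
  obtain ⟨W, hW⟩ : ∃ W : ℚ, W = u.den * v.den := ⟨_, rfl⟩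
  obtain ⟨h, hh⟩ : ∃ h : ℚ, h = (1 + u) * (1 + v) := ⟨_, rfl⟩
  have hW0 : 0 < W := by rw [hW]; positivity
  have hh0 : 0 < h := by rw [hh]; positivity
  obtain ⟨d, hd⟩ : ∃ d : ℕ → ℕ, ∀ n, (d n : ℚ) = interleave u.den v.den y t n := by
    refine ⟨fun n => if Odd n then u.den * y ^ ((n + 1) / 2) else v.den * t ^ (n / 2), fun n => ?_⟩
    unfold interleave
    push_cast
    rfl
  have hd1 : ∀ n, 1 ≤ d n := by
    intro n
    have : (1 : ℚ) ≤ d n := by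
      rw [hd]
      exact le_interleave zero_le_one (by exact_mod_cast u.den_pos) (by exact_mod_cast v.den_pos)
        (by exact_mod_cast hy) (by exact_mod_cast ht) n
    exact_mod_cast this
  have hdz : ∀ n, ∃ z : ℤ, (d n : ℚ) * interleave u v (x / y) (s / t) n = z := by
    intro n
    rw [hd]
    exact exists_int_eq_den_mul_interleave u v hy ht n
  have hD : ∀ m, ∏ i ∈ Finset.range (2 * m + 2), (d (i + 1) : ℚ) =
      W ^ (m + 1) * (y * t) ^ triangular (m + 1) := by
    intro m
    rw [Finset.prod_congr rfl fun i _ => hd (i + 1), hW, ← prod_range_interleave]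
    rfl
  have hU : ∀ m, ∏ i ∈ Finset.range (2 * m + 2), (1 + interleave u v (x / y) (s / t) (i + 1)) ≤
      h ^ (m + 1) * (x / y * (s / t)) ^ triangular (m + 1) := by
    intro m
    rw [hh, ← prod_range_interleave]
    refine Finset.prod_le_prod (fun i _ => ?_) fun i _ => one_add_interleave_le ha hb _
    have := hβb i
    linarith
  have hQ : ∀ m, (∏ i ∈ Finset.range (2 * m + 2), (d (i + 1) : ℚ)) *
      ∏ i ∈ Finset.range (2 * m + 2), (1 + interleave u v (x / y) (s / t) (i + 1)) ≤
      (W * h * (x * s)) * ((W * h * (x * s)) ^ m * (x * s) ^ triangular m) := by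
    intro m
    rw [hD]
    refine (mul_le_mul_of_nonneg_left (hU m) (by positivity)).trans_eq ?_
    have e : (x * s : ℚ) = (y * t) * (x / y * (s / t)) := by field_simp
    rw [triangular_succ, e]
    ring
  have hε : ∀ m, (∏ i ∈ Finset.range (2 * m + 2), (d (i + 1) : ℚ)) /
      (β ^ 2 * ∏ i ∈ Finset.range (2 * m), interleave u v (x / y) (s / t) (i + 1)) =
      (W * (y * t) / β ^ 2) *
        ((W * (y * t) / (u * v)) ^ m * ((y * t) ^ 2 / (x * s)) ^ triangular m) := by
    intro m
    have e : ((y * t) ^ 2 / (x * s) : ℚ) = (y * t) / (x / y * (s / t)) := by field_simp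
    have hα : (0 : ℚ) < x / y * (s / t) := by positivity
    rw [hD, prod_range_interleave, triangular_succ, e, div_pow _ (x / y * (s / t) : ℚ),
      div_pow _ (u * v)]
    generalize (x / y * (s / t) : ℚ) = α at hα
    rw [pow_add (y * t : ℚ), pow_succ W, pow_succ (y * t : ℚ) m, mul_pow W]
    field_simp
  have hWR : (0 : ℝ) < W := by exact_mod_cast hW0
  have hhR : (0 : ℝ) < h := by exact_mod_cast hh0
  have huR : (0 : ℝ) < u := by exact_mod_cast hu
  have hvR : (0 : ℝ) < v := by exact_mod_cast hv
  have hβR : (0 : ℝ) < β := by exact_mod_cast hβ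
  refine ⟨W * h * (x * s), by positivity, W * (y * t) / β ^ 2, by positivity,
    W * h * (x * s), by positivity, W * (y * t) / (u * v), by positivity, fun m => ?_⟩
  obtain ⟨p, q, p', q', hne, h1, h2, h3, h4⟩ :=
    exists_int_approx hβ hβ1 hβb hdz hd1 happ (2 * m)
  have hQR := Rat.cast_le (K := ℝ).mpr (hQ m)
  rw [hε m] at h3 h4
  push_cast at hQR h1 h2 h3 h4
  exact ⟨p, q, p', q', hne, h1.trans hQR, h2.trans hQR, h3, h4⟩

/-- The inequality between exponents behind the irrationality measure of `T₂(u,v,a,b)`. -/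
lemma tasoev_mul_rpow_lt_one {μ X Y w : ℝ} (hY : 1 ≤ Y) (hYw : Y < w) (hwX : w ^ 2 ≤ X)
    (hμ : 2 + Real.log Y / (Real.log w - Real.log Y) < μ) :
    X * (Y ^ 2 / X) ^ (μ - 1) < 1 := by
  have hY0 : 0 < Y := by linarith
  have hw0 : 0 < w := by linarith
  have hX0 : 0 < X := by nlinarith
  have hL : 0 ≤ Real.log Y := Real.log_nonneg hY
  have hlt : 0 < Real.log w - Real.log Y := sub_pos.mpr (Real.log_lt_log hY0 hYw)
  have hlX : 2 * Real.log w ≤ Real.log X := by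
    have := Real.log_le_log (by positivity) hwX
    rwa [Real.log_pow, Nat.cast_ofNat] at this
  have h1 : 1 ≤ μ - 1 := by
    have : 0 ≤ Real.log Y / (Real.log w - Real.log Y) := by positivity
    linarith
  have h2 : Real.log Y < (μ - 2) * (Real.log w - Real.log Y) := by
    rw [← div_lt_iff₀ hlt]
    linarith
  rw [← Real.log_neg_iff (by positivity), Real.log_mul hX0.ne' (by positivity),
    Real.log_rpow (by positivity), Real.log_div (by positivity) hX0.ne', Real.log_pow]
  push_cast
  nlinarith [mul_nonneg (sub_nonneg.mpr h1) (sub_nonneg.mpr hlX)]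

/-- Tasoev's continued fraction
`T₂(u,v,a,b) = 1/(ua) + 1/(vb) + 1/(ua²) + 1/(vb²) + ⋯` (all partial numerators
`1`, partial denominators `u·aᵏ` at index `2k-1` and `v·bᵏ` at index `2k`) with
`a = x/y`, `b = s/t`, `y·t < min{x,s}`, converges to an irrational number with
`μ_I ≤ 2 + (log y + log t)/(log min{x,s} - log y - log t)`. -/
theorem tasoev_T2_muI_le
    (u v : ℚ) (hu : 0 < u) (hv : 0 < v)
    (x y s t : ℕ) (hx : 1 ≤ x) (hy : 1 ≤ y) (hs : 1 ≤ s) (ht : 1 ≤ t)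
    (hyt : y * t < min x s) :
    ∃ τ : ℝ,
      Tendsto (fun n =>
          ((cfAQ (fun _ => 1)
              (fun n => if Odd n then u * ((x : ℚ) / (y : ℚ)) ^ ((n + 1) / 2)
                        else v * ((s : ℚ) / (t : ℚ)) ^ (n / 2)) n : ℝ) /
           (cfBQ (fun _ => 1)
              (fun n => if Odd n then u * ((x : ℚ) / (y : ℚ)) ^ ((n + 1) / 2)
                        else v * ((s : ℚ) / (t : ℚ)) ^ (n / 2)) n : ℝ)))
        atTop (nhds τ) ∧
      Irrational τ ∧
      muI τ ≤ ((2 + (Real.log (y : ℝ) + Real.log (t : ℝ)) /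
        (Real.log (min x s : ℕ) - Real.log (y : ℝ) - Real.log (t : ℝ)) : ℝ) : EReal) := by
  have hyt' : 1 ≤ y * t := Nat.mul_pos hy ht
  have hyx : y ≤ x := (Nat.le_mul_of_pos_right y ht).trans (hyt.le.trans (min_le_left _ _))
  have hts : t ≤ s := (Nat.le_mul_of_pos_left t hy).trans (hyt.le.trans (min_le_right _ _))
  obtain ⟨τ, hτ, C₁, hC₁, C₂, hC₂, G₁, hG₁, G₂, hG₂, happrox⟩ :=
    tasoev_exists_approx hu hv hy ht hyx hts
  have hY : (1 : ℝ) ≤ y * t := by exact_mod_cast hyt'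
  have hYw : (y * t : ℝ) < (min x s : ℕ) := by exact_mod_cast hyt
  have hwX : ((min x s : ℕ) : ℝ) ^ 2 ≤ x * s := by
    rw [sq]
    exact_mod_cast Nat.mul_le_mul (min_le_left x s) (min_le_right x s)
  have hX : (0 : ℝ) < x * s := by nlinarith
  have hρ1 : ((y * t) ^ 2 / (x * s) : ℝ) < 1 := by
    rw [div_lt_one hX]
    nlinarith
  have hlog : Real.log (y * t : ℝ) = Real.log y + Real.log t :=
    Real.log_mul (by positivity) (by positivity)
  rw [sub_sub, ← hlog]
  have hpos : 0 ≤ Real.log (y * t : ℝ) / (Real.log (min x s : ℕ) - Real.log (y * t : ℝ)) :=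
    div_nonneg (Real.log_nonneg hY)
      (sub_nonneg.mpr (Real.log_le_log (by linarith) hYw.le))
  have hmem : ∀ μ : ℝ,
      2 + Real.log (y * t : ℝ) / (Real.log (min x s : ℕ) - Real.log (y * t : ℝ)) < μ →
      ∃ c > (0 : ℝ), ∃ N₀ > (0 : ℝ), ∀ M N : ℤ,
        (N : ℝ) ≥ N₀ → |τ - (M : ℝ) / (N : ℝ)| ≥ c / (N : ℝ) ^ μ := fun μ hμ =>
    exists_le_abs_sub_of_triangular (by linarith) hX (by positivity) hρ1 hC₁ hC₂ hG₁ hG₂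
      (tasoev_mul_rpow_lt_one hY hYw hwX hμ) happrox
  refine ⟨τ, hτ, irrational_of_exists_le_abs_sub (hmem _ (lt_add_one _)), ?_⟩
  refine EReal.le_of_forall_lt_iff_le.mp fun μ hμ => sInf_le ⟨μ, hmem μ ?_, rfl⟩
  exact_mod_cast hμ
end

section
/- Let (t_n)_{n≥1} be the Thue–Morse binary sequence, i.e., t_n ∈ {0,1} is the parity of the number of ones in the binary representation of n − 1 (equivalently, the fixed point starting with 0 of the morphism 0 ↦ 01, 1 ↦ 10). Then the generalized continued fraction τ_t = K_{n=1}^∞ 2^{t_n}/2^{t_n+1}, with partial numerators a_n = 2^{t_n} and partial denominators b_n = 2^{t_n+1}, converges to an irrational number τ_t with μ_I(τ_t) ≤ 2 + (log 2)/(log(5 + 4√2) − log 2). -/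
open Filter

/-- Numerators of the convergents of the generalized continued fraction
`K_{n=1}^∞ a n / b n`. -/
def cfA (a b : ℕ → ℤ) : ℕ → ℤ
  | 0 => 0
  | 1 => a 1
  | (n + 2) => b (n + 2) * cfA a b (n + 1) + a (n + 2) * cfA a b n

/-- Denominators of the convergents of the generalized continued fraction
`K_{n=1}^∞ a n / b n`. -/
def cfB (a b : ℕ → ℤ) : ℕ → ℤ
  | 0 => 1
  | 1 => b 1
  | (n + 2) => b (n + 2) * cfB a b (n + 1) + a (n + 2) * cfB a b n

/-- The Thue–Morse binary sequence (indexed from `1`): `thueMorse n` is the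
parity of the number of ones in the binary representation of `n - 1`. -/
def thueMorse (n : ℕ) : ℕ := ((Nat.digits 2 (n - 1)).count 1) % 2

theorem thueMorse_le_one (n : ℕ) : thueMorse n ≤ 1 := by
  unfold thueMorse; omega

theorem thueMorse_pair (k : ℕ) : thueMorse (2 * k + 1) + thueMorse (2 * k + 2) = 1 := by
  have hodd : Nat.digits 2 (2 * k + 1) = 1 :: Nat.digits 2 k := by
    rw [Nat.digits_def' (by norm_num) (by omega), show (2 * k + 1) % 2 = 1 by omega,
      show (2 * k + 1) / 2 = k by omega]
  have heven : (Nat.digits 2 (2 * k)).count 1 = (Nat.digits 2 k).count 1 := by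
    rcases Nat.eq_zero_or_pos k with rfl | hk
    · simp
    · rw [Nat.digits_def' (by norm_num) (by omega)]
      simp
  have h1 : 2 * k + 1 - 1 = 2 * k := by omega
  have h2 : 2 * k + 2 - 1 = 2 * k + 1 := by omega
  unfold thueMorse
  rw [h1, h2, heven, hodd, List.count_cons_self]
  omega

/-- Numerators of the convergents of `K 2^{t_n} / 2^{t_n + 1}`. -/
def gcfNum (t : ℕ → ℕ) (n : ℕ) : ℤ := cfA (fun n => 2 ^ t n) (fun n => 2 ^ (t n + 1)) n

/-- Denominators of the convergents of `K 2^{t_n} / 2^{t_n + 1}`. -/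
def gcfDen (t : ℕ → ℕ) (n : ℕ) : ℤ := cfB (fun n => 2 ^ t n) (fun n => 2 ^ (t n + 1)) n

theorem gcfNum_zero (t : ℕ → ℕ) : gcfNum t 0 = 0 := rfl

theorem gcfNum_one (t : ℕ → ℕ) : gcfNum t 1 = 2 ^ t 1 := rfl

theorem gcfNum_add_two (t : ℕ → ℕ) (n : ℕ) :
    gcfNum t (n + 2) = 2 ^ t (n + 2) * (2 * gcfNum t (n + 1) + gcfNum t n) := by
  simp only [gcfNum, cfA]; ring

theorem gcfDen_zero (t : ℕ → ℕ) : gcfDen t 0 = 1 := rfl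

theorem gcfDen_one (t : ℕ → ℕ) : gcfDen t 1 = 2 * 2 ^ t 1 := by
  simp only [gcfDen, cfB]; ring

theorem gcfDen_add_two (t : ℕ → ℕ) (n : ℕ) :
    gcfDen t (n + 2) = 2 ^ t (n + 2) * (2 * gcfDen t (n + 1) + gcfDen t n) := by
  simp only [gcfDen, cfB]; ring

theorem gcfDen_pos (t : ℕ → ℕ) (n : ℕ) : 0 < gcfDen t n := by
  induction n using Nat.twoStepInduction with
  | zero => simp [gcfDen_zero]
  | one => rw [gcfDen_one]; positivity
  | more n h0 h1 => rw [gcfDen_add_two]; positivity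

theorem two_mul_gcfDen_le (t : ℕ → ℕ) (n : ℕ) : 2 * gcfDen t n ≤ gcfDen t (n + 1) := by
  rcases n with _ | n
  · rw [zero_add, gcfDen_one, gcfDen_zero]
    have := one_le_pow₀ (n := t 1) (show (1 : ℤ) ≤ 2 by norm_num)
    linarith
  · rw [gcfDen_add_two]
    have := one_le_pow₀ (n := t (n + 2)) (show (1 : ℤ) ≤ 2 by norm_num)
    nlinarith [gcfDen_pos t n, gcfDen_pos t (n + 1)]

theorem gcfDen_succ_le {t : ℕ → ℕ} (ht : ∀ n, t n ≤ 1) (n : ℕ) :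
    gcfDen t (n + 1) ≤ 6 * gcfDen t n := by
  have hpow (m : ℕ) : (2 : ℤ) ^ t m ≤ 2 := by
    simpa using pow_le_pow_right₀ (show (1 : ℤ) ≤ 2 by norm_num) (ht m)
  rcases n with _ | n
  · rw [zero_add, gcfDen_one, gcfDen_zero]
    linarith [hpow 1]
  · rw [gcfDen_add_two]
    nlinarith [gcfDen_pos t n, gcfDen_pos t (n + 1), two_mul_gcfDen_le t n, hpow (n + 2)]

theorem gcf_determinant (t : ℕ → ℕ) (n : ℕ) :
    gcfNum t (n + 1) * gcfDen t n - gcfNum t n * gcfDen t (n + 1) =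
      (-1) ^ n * 2 ^ (∑ i ∈ Finset.range (n + 1), t (i + 1)) := by
  induction n with
  | zero => simp [gcfNum_zero, gcfNum_one, gcfDen_zero]
  | succ n ih =>
    rw [Finset.sum_range_succ, pow_add, gcfNum_add_two, gcfDen_add_two]
    linear_combination (-(2 : ℤ) ^ t (n + 2)) * ih

/-- The distance between consecutive convergents. -/
noncomputable def gcfGap (t : ℕ → ℕ) (n : ℕ) : ℝ :=
  2 ^ (∑ i ∈ Finset.range (n + 1), t (i + 1)) / (gcfDen t n * gcfDen t (n + 1))

theorem dist_gcf_convergents (t : ℕ → ℕ) (n : ℕ) :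
    dist ((gcfNum t n : ℝ) / gcfDen t n) (gcfNum t (n + 1) / gcfDen t (n + 1)) = gcfGap t n := by
  have h0 : (0 : ℝ) < gcfDen t n := by exact_mod_cast gcfDen_pos t n
  have h1 : (0 : ℝ) < gcfDen t (n + 1) := by exact_mod_cast gcfDen_pos t (n + 1)
  have hdet : (gcfNum t (n + 1) * gcfDen t n - gcfNum t n * gcfDen t (n + 1) : ℝ) =
      (-1) ^ n * 2 ^ (∑ i ∈ Finset.range (n + 1), t (i + 1)) := by
    exact_mod_cast gcf_determinant t n
  rw [dist_comm, Real.dist_eq, div_sub_div _ _ h1.ne' h0.ne', mul_comm (gcfDen t (n + 1) : ℝ)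
    (gcfNum t n), hdet, abs_div, abs_mul, abs_pow, abs_neg, abs_one, one_pow, one_mul,
    abs_of_pos (by positivity), abs_of_pos (by positivity), gcfGap, mul_comm (gcfDen t n : ℝ)]

theorem gcfGap_nonneg (t : ℕ → ℕ) (n : ℕ) : 0 ≤ gcfGap t n := by
  rw [← dist_gcf_convergents]; exact dist_nonneg

theorem gcfGap_succ_le (t : ℕ → ℕ) (n : ℕ) : gcfGap t (n + 1) ≤ gcfGap t n * (1 / 2) := by
  have h0 : (0 : ℝ) < gcfDen t n := by exact_mod_cast gcfDen_pos t n
  have h1 : (0 : ℝ) < gcfDen t (n + 1) := by exact_mod_cast gcfDen_pos t (n + 1)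
  have h01 : (2 : ℝ) * gcfDen t n ≤ gcfDen t (n + 1) := by exact_mod_cast two_mul_gcfDen_le t n
  have h2 : (gcfDen t (n + 2) : ℝ) = 2 ^ t (n + 2) * (2 * gcfDen t (n + 1) + gcfDen t n) := by
    exact_mod_cast gcfDen_add_two t n
  have hgap : gcfGap t (n + 1) = gcfGap t n * (gcfDen t n /
      (2 * gcfDen t (n + 1) + gcfDen t n)) := by
    simp only [gcfGap, h2, Finset.sum_range_succ _ (n + 1), pow_add]
    field_simp
  rw [hgap]
  refine mul_le_mul_of_nonneg_left ?_ (gcfGap_nonneg t n)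
  rw [div_le_div_iff₀ (by positivity) (by norm_num)]
  linarith

theorem gcfGap_add_le (t : ℕ → ℕ) (n m : ℕ) : gcfGap t (n + m) ≤ gcfGap t n * (1 / 2) ^ m := by
  induction m with
  | zero => simp
  | succ m ih =>
    rw [← add_assoc, pow_succ]
    linarith [gcfGap_succ_le t (n + m)]

theorem exists_tendsto_gcf (t : ℕ → ℕ) :
    ∃ τ : ℝ, Tendsto (fun n => (gcfNum t n : ℝ) / gcfDen t n) atTop (nhds τ) := by
  refine cauchySeq_tendsto_of_complete
    (cauchySeq_of_le_geometric (1 / 2) (gcfGap t 0) (by norm_num) fun n => ?_)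
  rw [dist_gcf_convergents]
  simpa using gcfGap_add_le t 0 n

theorem abs_gcfDen_mul_sub_le {t : ℕ → ℕ} {τ : ℝ}
    (hτ : Tendsto (fun n => (gcfNum t n : ℝ) / gcfDen t n) atTop (nhds τ)) (n : ℕ) :
    |gcfDen t n * τ - gcfNum t n| ≤
      2 * 2 ^ (∑ i ∈ Finset.range (n + 1), t (i + 1)) / gcfDen t (n + 1) := by
  have h0 : (0 : ℝ) < gcfDen t n := by exact_mod_cast gcfDen_pos t n
  have h1 : (0 : ℝ) < gcfDen t (n + 1) := by exact_mod_cast gcfDen_pos t (n + 1)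
  have hshift : Tendsto (fun m => (gcfNum t (n + m) : ℝ) / gcfDen t (n + m)) atTop (nhds τ) := by
    simpa only [add_comm n] using (tendsto_add_atTop_iff_nat n).2 hτ
  have hdist := dist_le_of_le_geometric_of_tendsto₀ (1 / 2) (gcfGap t n) (by norm_num)
    (fun m => by
      rw [← add_assoc, dist_gcf_convergents]
      exact gcfGap_add_le t n m) hshift
  rw [add_zero, dist_comm, Real.dist_eq] at hdist
  have hmul : (gcfDen t n * τ - gcfNum t n : ℝ) = gcfDen t n * (τ - gcfNum t n / gcfDen t n) := by
    field_simp
  rw [hmul, abs_mul, abs_of_pos h0]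
  refine (mul_le_mul_of_nonneg_left hdist h0.le).trans_eq ?_
  rw [gcfGap]
  field_simp
  norm_num

theorem sum_range_two_mul {t : ℕ → ℕ} (hpair : ∀ k, t (2 * k + 1) + t (2 * k + 2) = 1) (k : ℕ) :
    ∑ i ∈ Finset.range (2 * k), t (i + 1) = k := by
  induction k with
  | zero => simp
  | succ k ih =>
    rw [show 2 * (k + 1) = 2 * k + 1 + 1 by ring, Finset.sum_range_succ, Finset.sum_range_succ, ih,
      add_assoc, hpair]

theorem pow_le_gcfDen_add {t : ℕ → ℕ} (hpair : ∀ k, t (2 * k + 1) + t (2 * k + 2) = 1) (k : ℕ) :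
    (5 + 4 * √2) ^ (k + 1) ≤ gcfDen t (2 * k + 2) + (√2 - 1) * gcfDen t (2 * k + 1) := by
  have hs : √2 * √2 = 2 := Real.mul_self_sqrt (by norm_num)
  have hs1 : 1.41 < √2 := Real.lt_sqrt_of_sq_lt (by norm_num)
  have hs2 : √2 < 1.42 := (Real.sqrt_lt' (by norm_num)).2 (by norm_num)
  have hcases (k : ℕ) : t (2 * k + 1) = 0 ∧ t (2 * k + 2) = 1 ∨
      t (2 * k + 1) = 1 ∧ t (2 * k + 2) = 0 := by have := hpair k; omega
  induction k with
  | zero =>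
    have h2 := gcfDen_add_two t 0
    rw [zero_add, zero_add, gcfDen_one, gcfDen_zero] at h2
    rw [mul_zero, zero_add, zero_add, pow_one, h2, gcfDen_one]
    rcases hcases 0 with ⟨e1, e2⟩ | ⟨e1, e2⟩ <;> rw [mul_zero, zero_add] at e1 e2 <;>
      rw [e1, e2] <;> push_cast <;> linarith
  | succ k ih =>
    have p1 : (0 : ℝ) < gcfDen t (2 * k + 1) := by exact_mod_cast gcfDen_pos t (2 * k + 1)
    have p2 : (0 : ℝ) < gcfDen t (2 * k + 2) := by exact_mod_cast gcfDen_pos t (2 * k + 2)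
    have h3 : (gcfDen t (2 * k + 3) : ℝ) =
        2 ^ t (2 * k + 3) * (2 * gcfDen t (2 * k + 2) + gcfDen t (2 * k + 1)) := by
      exact_mod_cast gcfDen_add_two t (2 * k + 1)
    have h4 : (gcfDen t (2 * k + 4) : ℝ) =
        2 ^ t (2 * k + 4) * (2 * gcfDen t (2 * k + 3) + gcfDen t (2 * k + 2)) := by
      exact_mod_cast gcfDen_add_two t (2 * k + 2)
    have hstep : (5 + 4 * √2) * (gcfDen t (2 * k + 2) + (√2 - 1) * gcfDen t (2 * k + 1)) ≤
        gcfDen t (2 * k + 4) + (√2 - 1) * gcfDen t (2 * k + 3) := by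
      have hexpand : (5 + 4 * √2) * (gcfDen t (2 * k + 2) + (√2 - 1) * gcfDen t (2 * k + 1)) =
          (5 + 4 * √2) * gcfDen t (2 * k + 2) + (3 + √2) * gcfDen t (2 * k + 1) := by
        linear_combination 4 * (gcfDen t (2 * k + 1) : ℝ) * hs
      rw [hexpand, h4, h3]
      rcases hcases (k + 1) with ⟨e1, e2⟩ | ⟨e1, e2⟩
      · rw [show 2 * (k + 1) + 1 = 2 * k + 3 by ring] at e1
        rw [show 2 * (k + 1) + 2 = 2 * k + 4 by ring] at e2
        rw [e1, e2]
        nlinarith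
      · rw [show 2 * (k + 1) + 1 = 2 * k + 3 by ring] at e1
        rw [show 2 * (k + 1) + 2 = 2 * k + 4 by ring] at e2
        rw [e1, e2]
        nlinarith
    rw [show 2 * (k + 1) + 2 = 2 * k + 4 by ring, show 2 * (k + 1) + 1 = 2 * k + 3 by ring,
      pow_succ']
    exact (mul_le_mul_of_nonneg_left ih (by positivity)).trans hstep

theorem pow_le_gcfDen {t : ℕ → ℕ} (ht : ∀ n, t n ≤ 1)
    (hpair : ∀ k, t (2 * k + 1) + t (2 * k + 2) = 1) (k : ℕ) :
    (5 + 4 * √2) ^ k ≤ gcfDen t (2 * k + 1) := by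
  have hs1 : 1.41 < √2 := Real.lt_sqrt_of_sq_lt (by norm_num)
  have hs2 : √2 < 1.42 := (Real.sqrt_lt' (by norm_num)).2 (by norm_num)
  have h := pow_le_gcfDen_add hpair k
  have hle : (gcfDen t (2 * k + 2) : ℝ) ≤ 6 * gcfDen t (2 * k + 1) := by
    exact_mod_cast gcfDen_succ_le ht (2 * k + 1)
  have hp : (0 : ℝ) < gcfDen t (2 * k + 1) := by exact_mod_cast gcfDen_pos t (2 * k + 1)
  have hpow : (0 : ℝ) < (5 + 4 * √2) ^ k := by positivity
  rw [pow_succ] at h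
  nlinarith

theorem abs_gcfDen_mul_sub_le_of_pair {t : ℕ → ℕ} (ht : ∀ n, t n ≤ 1)
    (hpair : ∀ k, t (2 * k + 1) + t (2 * k + 2) = 1) {τ : ℝ}
    (hτ : Tendsto (fun n => (gcfNum t n : ℝ) / gcfDen t n) atTop (nhds τ)) (k : ℕ) :
    |gcfDen t (2 * k) * τ - gcfNum t (2 * k)| ≤ 4 * 2 ^ k / gcfDen t (2 * k + 1) ∧
    |gcfDen t (2 * k + 1) * τ - gcfNum t (2 * k + 1)| ≤ 4 * 2 ^ k / gcfDen t (2 * k + 1) := by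
  have hp : (0 : ℝ) < gcfDen t (2 * k + 1) := by exact_mod_cast gcfDen_pos t (2 * k + 1)
  have hmono : (gcfDen t (2 * k + 1) : ℝ) ≤ gcfDen t (2 * k + 2) := by
    have h1 : (2 * gcfDen t (2 * k + 1) : ℝ) ≤ gcfDen t (2 * k + 2) := by
      exact_mod_cast two_mul_gcfDen_le t (2 * k + 1)
    linarith
  constructor
  · refine (abs_gcfDen_mul_sub_le hτ (2 * k)).trans ?_
    rw [Finset.sum_range_succ, sum_range_two_mul hpair]
    have h2 : (2 : ℝ) ^ t (2 * k + 1) ≤ 2 := by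
      simpa using pow_le_pow_right₀ (show (1 : ℝ) ≤ 2 by norm_num) (ht (2 * k + 1))
    have h2k : (0 : ℝ) < 2 ^ k := by positivity
    rw [pow_add]
    refine div_le_div_of_nonneg_right ?_ hp.le
    nlinarith
  · refine (abs_gcfDen_mul_sub_le hτ (2 * k + 1)).trans ?_
    rw [show 2 * k + 1 + 1 = 2 * (k + 1) by ring, sum_range_two_mul hpair, pow_succ,
      show 2 * ((2 : ℝ) ^ k * 2) = 4 * 2 ^ k by ring]
    exact div_le_div_of_nonneg_left (by positivity) hp hmono

/-- A good rational approximation `p / q` different from `M / N` keeps `M / N` away from `τ`. -/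
theorem half_le_mul_abs_sub {τ : ℝ} {p q M N : ℤ} (hq : 0 < q) (hN : 0 < N)
    (hne : N * p - M * q ≠ 0) (happrox : (N : ℝ) * |q * τ - p| ≤ 1 / 2) :
    1 / 2 ≤ (q : ℝ) * |N * τ - M| := by
  have hint : (1 : ℝ) ≤ |(N * p - M * q : ℝ)| := by
    exact_mod_cast Int.one_le_abs hne
  have hqR : (0 : ℝ) < q := by exact_mod_cast hq
  have hNR : (0 : ℝ) < N := by exact_mod_cast hN
  have hsplit : (N * p - M * q : ℝ) = q * (N * τ - M) - N * (q * τ - p) := by ring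
  rw [hsplit] at hint
  have habs := abs_sub (q * (N * τ - M) : ℝ) (N * (q * τ - p))
  rw [abs_mul, abs_mul, abs_of_pos hqR, abs_of_pos hNR] at habs
  linarith

theorem exists_approximation_lower_bound {t : ℕ → ℕ} (ht : ∀ n, t n ≤ 1)
    (hpair : ∀ k, t (2 * k + 1) + t (2 * k + 2) = 1) {τ : ℝ}
    (hτ : Tendsto (fun n => (gcfNum t n : ℝ) / gcfDen t n) atTop (nhds τ))
    (M N : ℤ) (hN : 1 ≤ N) :
    ∃ k : ℕ, 1 / (576 * N * 2 ^ k) ≤ |N * τ - M| ∧ ((5 + 4 * √2) / 2) ^ k ≤ 8 * N := by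
  have hNR : (1 : ℝ) ≤ N := by exact_mod_cast hN
  have hs1 : 1 < √2 := Real.lt_sqrt_of_sq_lt (by norm_num)
  have hdenpos (n : ℕ) : (0 : ℝ) < gcfDen t n := by exact_mod_cast gcfDen_pos t n
  have hex : ∃ k : ℕ, (N : ℝ) * (4 * 2 ^ k / gcfDen t (2 * k + 1)) ≤ 1 / 2 := by
    obtain ⟨k, hk⟩ := pow_unbounded_of_one_lt (8 * N : ℝ)
      (show 1 < (5 + 4 * √2) / 2 by linarith)
    refine ⟨k, ?_⟩
    rw [div_pow, lt_div_iff₀ (by positivity)] at hk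
    rw [← mul_div_assoc, div_le_iff₀ (hdenpos _)]
    linarith [pow_le_gcfDen ht hpair k]
  classical
  obtain ⟨k, hk⟩ : ∃ k, Nat.find hex = k + 1 := by
    refine Nat.exists_eq_succ_of_ne_zero fun h0 => ?_
    have h := Nat.find_spec hex
    rw [h0] at h
    have h1 : (gcfDen t 1 : ℝ) ≤ 6 := by
      have := gcfDen_succ_le ht 0
      rw [gcfDen_zero] at this
      exact_mod_cast this
    rw [← mul_div_assoc, div_le_iff₀ (hdenpos _)] at h
    norm_num at h
    linarith
  have hsmall := Nat.find_spec hex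
  have hlarge := Nat.find_min hex (m := k) (by omega)
  rw [hk] at hsmall
  rw [not_le, ← mul_div_assoc, lt_div_iff₀ (hdenpos _)] at hlarge
  have hNpos : (0 : ℝ) < N := by linarith
  refine ⟨k, ?_, ?_⟩
  · have hkey : 1 / 2 ≤ (gcfDen t (2 * (k + 1) + 1) : ℝ) * |N * τ - M| := by
      obtain ⟨he, ho⟩ := abs_gcfDen_mul_sub_le_of_pair ht hpair hτ (k + 1)
      by_cases hne : N * gcfNum t (2 * (k + 1) + 1) - M * gcfDen t (2 * (k + 1) + 1) = 0
      · have hne' : N * gcfNum t (2 * (k + 1)) - M * gcfDen t (2 * (k + 1)) ≠ 0 := by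
          intro h0
          have hdet := gcf_determinant t (2 * (k + 1))
          have hzero : N * (gcfNum t (2 * (k + 1) + 1) * gcfDen t (2 * (k + 1)) -
              gcfNum t (2 * (k + 1)) * gcfDen t (2 * (k + 1) + 1)) = 0 := by
            linear_combination gcfDen t (2 * (k + 1)) * hne - gcfDen t (2 * (k + 1) + 1) * h0
          rw [hdet] at hzero
          have : N ≠ 0 := by omega
          simp_all
        have h := half_le_mul_abs_sub (gcfDen_pos t (2 * (k + 1))) (by omega) hne'
          ((mul_le_mul_of_nonneg_left he hNpos.le).trans hsmall)
        have hmono : (2 * gcfDen t (2 * (k + 1)) : ℝ) ≤ gcfDen t (2 * (k + 1) + 1) := by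
          exact_mod_cast two_mul_gcfDen_le t (2 * (k + 1))
        refine h.trans (mul_le_mul_of_nonneg_right ?_ (abs_nonneg _))
        linarith [hdenpos (2 * (k + 1))]
      · exact half_le_mul_abs_sub (gcfDen_pos t (2 * (k + 1) + 1)) (by omega) hne
          ((mul_le_mul_of_nonneg_left ho hNpos.le).trans hsmall)
    have h1 : (gcfDen t (2 * (k + 1) + 1) : ℝ) ≤ 6 * gcfDen t (2 * k + 2) := by
      exact_mod_cast gcfDen_succ_le ht (2 * k + 2)
    have h2 : (gcfDen t (2 * k + 2) : ℝ) ≤ 6 * gcfDen t (2 * k + 1) := by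
      exact_mod_cast gcfDen_succ_le ht (2 * k + 1)
    have hden : (gcfDen t (2 * (k + 1) + 1) : ℝ) ≤ 288 * N * 2 ^ k := by linarith
    rw [div_le_iff₀ (by positivity)]
    nlinarith [mul_le_mul_of_nonneg_right hden (abs_nonneg (N * τ - M : ℝ))]
  · rw [div_pow, div_le_iff₀ (by positivity)]
    linarith [pow_le_gcfDen ht hpair k]

/-- With `δ = log b / log a`, a bound on `a ^ k` gives a bound on `b ^ k`. -/
theorem pow_le_rpow_log_div_log {a b x : ℝ} (ha : 1 < a) (hb : 1 < b) {k : ℕ} (hx : a ^ k ≤ x) :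
    b ^ k ≤ x ^ (Real.log b / Real.log a) := by
  have hla : 0 < Real.log a := Real.log_pos ha
  have ha0 : 0 < a := by linarith
  have hab : a ^ (Real.log b / Real.log a) = b := by
    rw [Real.rpow_def_of_pos ha0, mul_div_cancel₀ _ hla.ne', Real.exp_log (by linarith)]
  calc b ^ k = (a ^ k) ^ (Real.log b / Real.log a) := by
        nth_rewrite 1 [← hab]
        rw [← Real.rpow_natCast, ← Real.rpow_mul ha0.le, mul_comm, Real.rpow_mul ha0.le,
          Real.rpow_natCast]
    _ ≤ x ^ (Real.log b / Real.log a) :=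
        Real.rpow_le_rpow (by positivity) hx (div_nonneg (Real.log_pos hb).le hla.le)

theorem exists_irrationality_bound {t : ℕ → ℕ} (ht : ∀ n, t n ≤ 1)
    (hpair : ∀ k, t (2 * k + 1) + t (2 * k + 2) = 1) {τ : ℝ}
    (hτ : Tendsto (fun n => (gcfNum t n : ℝ) / gcfDen t n) atTop (nhds τ)) :
    ∃ c > (0 : ℝ), ∀ M N : ℤ, (N : ℝ) ≥ 1 → |τ - (M : ℝ) / (N : ℝ)| ≥
      c / (N : ℝ) ^ (2 + Real.log 2 / (Real.log (5 + 4 * √2) - Real.log 2)) := by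
  have hs1 : 1 < √2 := Real.lt_sqrt_of_sq_lt (by norm_num)
  rw [← Real.log_div (by positivity) (by norm_num)]
  set δ := Real.log 2 / Real.log ((5 + 4 * √2) / 2)
  refine ⟨1 / (576 * 8 ^ δ), by positivity, fun M N hN => ?_⟩
  have hNpos : (0 : ℝ) < N := by linarith
  obtain ⟨k, hk, hpow⟩ := exists_approximation_lower_bound ht hpair hτ M N (by exact_mod_cast hN)
  have h2k : (2 : ℝ) ^ k ≤ 8 ^ δ * N ^ δ := by
    rw [← Real.mul_rpow (by norm_num) hNpos.le]
    exact pow_le_rpow_log_div_log (by linarith) (by norm_num) hpow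
  have hτN : τ - M / N = (N * τ - M) / N := by field_simp
  rw [ge_iff_le, hτN, abs_div, abs_of_pos hNpos, Real.rpow_add hNpos, Real.rpow_two,
    le_div_iff₀ hNpos]
  refine le_trans ?_ hk
  calc 1 / (576 * 8 ^ δ) / ((N : ℝ) ^ 2 * N ^ δ) * N = 1 / (576 * N * (8 ^ δ * N ^ δ)) := by
        field_simp
    _ ≤ 1 / (576 * N * 2 ^ k) := by gcongr

/-- A real number bounded away from all fractions with positive denominator is irrational. -/
theorem irrational_of_forall_abs_sub_ge {τ c μ : ℝ} (hc : 0 < c)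
    (h : ∀ M N : ℤ, (N : ℝ) ≥ 1 → |τ - (M : ℝ) / (N : ℝ)| ≥ c / (N : ℝ) ^ μ) :
    Irrational τ := by
  rintro ⟨r, rfl⟩
  have hden : (1 : ℝ) ≤ r.den := by exact_mod_cast r.den_pos
  have hr := h r.num r.den (by exact_mod_cast hden)
  rw [Int.cast_natCast, ← Rat.cast_def, sub_self, abs_zero] at hr
  have : 0 < c / (r.den : ℝ) ^ μ := by positivity
  linarith

/-- the continued fraction `τ_t = K_{n=1}^∞ 2^{t_n} / 2^{t_n + 1}`
built from the Thue–Morse sequence `(t_n)` converges to an irrational number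
with `μ_I(τ_t) ≤ 2 + log 2 / (log (5 + 4√2) - log 2)`. -/
theorem thue_morse_gcf_muI_le :
    ∃ τ : ℝ,
      Tendsto (fun n =>
          ((cfA (fun n => 2 ^ thueMorse n) (fun n => 2 ^ (thueMorse n + 1)) n : ℝ) /
           (cfB (fun n => 2 ^ thueMorse n) (fun n => 2 ^ (thueMorse n + 1)) n : ℝ)))
        atTop (nhds τ) ∧
      Irrational τ ∧
      muI τ ≤ ((2 + Real.log 2 / (Real.log (5 + 4 * Real.sqrt 2) - Real.log 2) : ℝ) : EReal) := by
  obtain ⟨τ, hτ⟩ := exists_tendsto_gcf thueMorse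
  obtain ⟨c, hc, hbound⟩ := exists_irrationality_bound thueMorse_le_one thueMorse_pair hτ
  exact ⟨τ, hτ, irrational_of_forall_abs_sub_ge hc hbound,
    sInf_le ⟨_, ⟨c, hc, 1, one_pos, hbound⟩, rfl⟩⟩
end
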